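/- For all non-negative integers a, b with 2a + b = 154, the system L_3(19; 4^{×a}, 3^{×b}) is non-special of virtual dimension −1; that is, there exist a + b pairwise linearly independent points in ℚ^4 \ {0} such that the only homogeneous polynomial of degree 19 in 4 variables over ℚ vanishing to order ≥ 4 at the first a points and ≥ 3 at the remaining b points is the zero polynomial, and indeed C(22,3) − 20a − 10b − 1 = 1540 − 10(2a+b) − 1 = −1. -/

import Mathlib

open MvPolynomial

/-- The differential operator `∂₀^{ν 0} ∂₁^{ν 1} ∂₂^{ν 2} ∂₃^{ν 3}` on polynomials
in 4 variables over `ℚ`. -/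
noncomputable def diffOp (ν : Fin 4 → ℕ) :
    Module.End ℚ (MvPolynomial (Fin 4) ℚ) :=
  ((pderiv (0 : Fin 4)).toLinearMap ^ ν 0) * ((pderiv (1 : Fin 4)).toLinearMap ^ ν 1) *
    ((pderiv (2 : Fin 4)).toLinearMap ^ ν 2) * ((pderiv (3 : Fin 4)).toLinearMap ^ ν 3)

/-- Polynomials all of whose partial derivatives of order `< m` (including order 0)
vanish at the point `pt : ℚ⁴`. -/
noncomputable def vanishingSpace (m : ℕ) (pt : Fin 4 → ℚ) :
    Submodule ℚ (MvPolynomial (Fin 4) ℚ) :=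
  ⨅ (ν : Fin 4 → ℕ) (_ : ∑ j, ν j < m),
    LinearMap.ker ((aeval pt).toLinearMap ∘ₗ
      (diffOp ν : MvPolynomial (Fin 4) ℚ →ₗ[ℚ] MvPolynomial (Fin 4) ℚ))

/-- `V(d; m_1,…,m_r; p_1,…,p_r)`: homogeneous polynomials of degree `d` in 4 variables
over `ℚ` vanishing to order `≥ ms[i]` at `pts i` for each `i`. -/
noncomputable def systemSpace (d : ℕ) (ms : List ℕ) (pts : Fin ms.length → Fin 4 → ℚ) :
    Submodule ℚ (MvPolynomial (Fin 4) ℚ) :=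
  homogeneousSubmodule (Fin 4) ℚ d ⊓ ⨅ i, vanishingSpace (ms.get i) (pts i)

/-- The virtual dimension `vdim L_3(d; m_1,…,m_r) = C(d+3,3) − Σ C(m_i+2,3) − 1`. -/
def vdim (d : ℕ) (ms : List ℕ) : ℤ :=
  ((d + 3).choose 3 : ℤ) - (ms.map fun m => ((m + 2).choose 3 : ℤ)).sum - 1

/-- The linear system `L_3(d; m_1,…,m_r)` is non-special: there exist pairwise linearly
independent points of `ℚ⁴ \ {0}` at which the space of degree-`d` homogeneous polynomials
with the prescribed multiplicities has dimension `max (vdim + 1) 0`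
(the expected dimension). -/
noncomputable def nonSpecial (d : ℕ) (ms : List ℕ) : Prop :=
  ∃ pts : Fin ms.length → Fin 4 → ℚ,
    (∀ i, pts i ≠ 0) ∧
    (∀ i j, i ≠ j → LinearIndependent ℚ ![pts i, pts j]) ∧
    (Module.finrank ℚ (systemSpace d ms pts) : ℤ) = max (vdim d ms + 1) 0

/-! ### Computable checker -/

/-- Exponent vectors (and weight vectors) in `ℕ⁴`. -/
abbrev Pt := ℕ × ℕ × ℕ × ℕ

/-- The weight of an exponent vector. -/
def wt : Pt → Pt → ℕ
  | (a, b, c, d), (i, j, k, l) =>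
    Nat.add (Nat.mul a i) (Nat.add (Nat.mul b j) (Nat.add (Nat.mul c k) (Nat.mul d l)))

/-- Orders of differentiation in the first three variables, of total order `< m`. -/
def nus : ℕ → List (ℕ × ℕ × ℕ)
  | 3 => [(0, 0, 0), (1, 0, 0), (0, 1, 0), (0, 0, 1), (2, 0, 0), (1, 1, 0), (1, 0, 1),
      (0, 2, 0), (0, 1, 1), (0, 0, 2)]
  | 4 => [(0, 0, 0), (1, 0, 0), (0, 1, 0), (0, 0, 1), (2, 0, 0), (1, 1, 0), (1, 0, 1),
      (0, 2, 0), (0, 1, 1), (0, 0, 2), (3, 0, 0), (2, 1, 0), (2, 0, 1), (1, 2, 0), (1, 1, 1),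
      (1, 0, 2), (0, 3, 0), (0, 2, 1), (0, 1, 2), (0, 0, 3)]
  | _ => []

/-- Product of falling factorials. -/
def fal (v : Pt) (n : ℕ × ℕ × ℕ) : ℕ :=
  v.1.descFactorial n.1 * (v.2.1.descFactorial n.2.1 * v.2.2.1.descFactorial n.2.2)

/-- Values of all the basic functions at `v`. -/
def bas (m : ℕ) (v : Pt) : List ℕ := (nus m).map (fal v)

/-- Evaluate a natural number before continuing. -/
def forceNat {β : Type} (n : ℕ) (k : ℕ → β) : β :=
  Nat.rec (k 0) (fun n _ => k (Nat.succ n)) n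

/-- Evaluate a list of naturals before continuing. -/
def forceList {β : Type} (l : List ℕ) : (List ℕ → β) → β :=
  List.rec (fun k => k []) (fun x _ ih k => forceNat x fun x => ih fun xs => k (x :: xs)) l

/-- Evaluate a list of rows before continuing. -/
def forceRows {β : Type} (l : List (List ℕ)) : (List (List ℕ) → β) → β :=
  List.rec (fun k => k [])
    (fun x _ ih k => forceList x fun x => ih fun xs => k (x :: xs)) l

/-- The prime used in the rank computations. -/
abbrev pr : ℕ := 1000003

/-- The combination `a • R + r • P` modulo `pr`. -/
def comb (a r : ℕ) : List ℕ → List ℕ → List ℕ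
  | x :: R, y :: P => Nat.mod (Nat.add (Nat.mul a x) (Nat.mul r y)) pr :: comb a r R P
  | _, _ => []

/-- Eliminate the first column of a row using the pivot row `a :: P`. -/
def redRow (a : ℕ) (P : List ℕ) : List ℕ → List ℕ
  | [] => []
  | x :: R => bif Nat.beq x 0 then R else comb a (Nat.sub pr (Nat.mod x pr)) R P

/-- Gaussian elimination; the first argument is fuel. -/
def gauss : ℕ → List (List ℕ) → Bool
  | _, [] => true
  | n + 1, (a :: P) :: Rs =>
      !(Nat.beq (Nat.mod a pr) 0) && forceRows (Rs.map (redRow a P)) fun Rs' => gauss n Rs'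
  | _, _ => false

/-- Equality test for exponent vectors. -/
def ptEq : Pt → Pt → Bool
  | (a, b, c, d), (i, j, k, l) => Nat.beq a i && (Nat.beq b j && (Nat.beq c k && Nat.beq d l))

/-- The weight vector is not a multiple of `(1,1,1,1)`. -/
def nonconst : Pt → Bool
  | (a, b, c, d) => !(Nat.beq a b && (Nat.beq b c && Nat.beq c d))

/-- A degeneration step: weight vector, threshold, exponents removed. -/
structure Step where
  w : Pt
  th : ℕ
  S : List Pt

/-- All weights in `l` exceed `th`. -/
def above (w : Pt) (th : ℕ) (l : List Pt) : Bool :=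
  l.all fun v => Nat.ble (Nat.succ th) (wt w v)

/-- Check one degeneration step removing the points `s.S` from `s.S :: L`. -/
def checkStep (m : ℕ) (s : Step) (L : List (List Pt)) : Bool :=
  nonconst s.w && (s.S.all (fun v => Nat.ble (wt s.w v) s.th) &&
    (L.all (above s.w s.th) &&
      forceRows (s.S.map (bas m)) fun R => gauss 20 R))

/-- Check a chain of steps, all with the same multiplicity. -/
def checkChain (m : ℕ) : List Step → List (List Pt) → Bool
  | [], _ => true
  | s :: ss, L => checkStep m s (ss.foldr (fun t M => t.S :: M) L) && checkChain m ss L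

/-- A block can be removed either by quadruple points or by triple points. -/
structure Blk where
  q : List Step
  t : List Step

/-- Remaining exponents, in groups. -/
def groups : List Blk → List (List Pt)
  | [] => []
  | B :: Bs => B.q.foldr (fun t M => t.S :: M) (groups Bs)

/-- Inclusion test. -/
def subPts (A B : List Step) : Bool :=
  A.all fun a => a.S.all fun v => B.any fun b => b.S.any fun u => ptEq v u

/-- Check one block. -/
def checkBlk (B : Blk) (L : List (List Pt)) : Bool :=
  checkChain 4 B.q L && (checkChain 3 B.t L && (subPts B.q B.t && subPts B.t B.q))

/-- Check all blocks. -/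
def checkAll : List Blk → Bool
  | [] => true
  | B :: Bs => checkBlk B (groups Bs) && checkAll Bs

/-- Injective code of exponent vectors of degree 19. -/
def code : Pt → ℕ
  | (i, j, k, _) => Nat.add (Nat.mul 400 i) (Nat.add (Nat.mul 20 j) k)

/-- Bit mask of a list of exponent vectors; also checks the degree. -/
def maskL : List Pt → ℕ → (ℕ → Bool) → Bool
  | [], acc, k => k acc
  | v :: vs, acc, k => Nat.beq (v.1 + (v.2.1 + (v.2.2.1 + v.2.2.2))) 19 &&
      forceNat (Nat.lor acc (Nat.shiftLeft 1 (code v))) fun acc => maskL vs acc k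

/-- Check that all exponent vectors of degree 19 occur. -/
def covers (L : List (List Pt)) : Bool :=
  maskL L.flatten 0 fun M =>
    (List.range 20).all fun i => (List.range 20).all fun j => (List.range 20).all fun k =>
      Nat.ble 20 (i + (j + k)) || Nat.testBit M (code (i, j, k, 0))

/-! ### Soundness of the elimination -/

theorem forceNat_eq {β : Type} (n : ℕ) (k : ℕ → β) : forceNat n k = k n := by
  cases n <;> rfl

theorem forceList_eq {β : Type} (l : List ℕ) (k : List ℕ → β) : forceList l k = k l := by
  induction l generalizing k with
  | nil => rfl
  | cons x xs ih =>
    change forceNat x (fun x => forceList xs fun xs => k (x :: xs)) = _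
    rw [forceNat_eq, ih]

theorem forceRows_eq {β : Type} (l : List (List ℕ)) (k : List (List ℕ) → β) :
    forceRows l k = k l := by
  induction l generalizing k with
  | nil => rfl
  | cons x xs ih =>
    change forceList x (fun x => forceRows xs fun xs => k (x :: xs)) = _
    rw [forceList_eq, ih]

/-- The prime is prime. -/
theorem pr_prime : Nat.Prime pr := by norm_num

instance pr_fact : Fact (Nat.Prime pr) := ⟨pr_prime⟩

/-- A combination of the `j`-th entries of the rows. -/
def rowSum (g : ℕ → ZMod pr) : List (List ℕ) → ℕ → ZMod pr
  | [], _ => 0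
  | R :: Rs, j => g 0 * ((R.getD j 0 : ℕ) : ZMod pr) + rowSum (fun i => g (i + 1)) Rs j

theorem comb_length (a r : ℕ) : ∀ R P : List ℕ, R.length = P.length →
    (comb a r R P).length = P.length := by
  intro R
  induction R with
  | nil => intro P h; cases P <;> simp_all [comb]
  | cons x R ih => intro P h; cases P <;> simp_all [comb]

theorem comb_getD (a r : ℕ) : ∀ R P : List ℕ, R.length = P.length → ∀ j,
    (((comb a r R P).getD j 0 : ℕ) : ZMod pr)
      = a * ((R.getD j 0 : ℕ) : ZMod pr) + r * ((P.getD j 0 : ℕ) : ZMod pr) := by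
  intro R
  induction R with
  | nil => intro P h j; cases P <;> simp_all [comb]
  | cons x R ih =>
    intro P h j
    cases P with
    | nil => simp at h
    | cons y P =>
      cases j with
      | zero =>
        change ((((a * x + r * y) % pr : ℕ)) : ZMod pr) = a * (x : ZMod pr) + r * (y : ZMod pr)
        rw [ZMod.natCast_mod]
        push_cast
        ring
      | succ j =>
        have := ih P (by simpa using h) j
        simpa [comb] using this

theorem redRow_length (a : ℕ) (P R : List ℕ) (h : R.length = P.length + 1) :
    (redRow a P R).length = P.length := by
  cases R with
  | nil => simp at h
  | cons x R =>
    have h' : R.length = P.length := by simpa using h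
    change (bif Nat.beq x 0 then R else comb a _ R P).length = _
    cases Nat.beq x 0
    · exact comb_length _ _ _ _ h'
    · exact h'

theorem rowSum_red (a : ℕ) (ha : (a : ZMod pr) ≠ 0) (P : List ℕ) (Rs : List (List ℕ)) :
    ∀ g : ℕ → ZMod pr, (∀ R ∈ Rs, R.length = P.length + 1) →
    ∃ g' : ℕ → ZMod pr,
      (∀ j, rowSum g' (Rs.map (redRow a P)) j
        = a * rowSum g Rs (j + 1) - rowSum g Rs 0 * ((P.getD j 0 : ℕ) : ZMod pr)) ∧
      ((∀ i < Rs.length, g' i = 0) → ∀ i < Rs.length, g i = 0) := by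
  induction Rs with
  | nil => intro g _; exact ⟨g, by simp [rowSum], by simp⟩
  | cons R Rs ih =>
    intro g hR
    obtain ⟨g', h1, h2⟩ := ih (fun i => g (i + 1)) (fun R' h => hR R' (by simp [h]))
    have hl := hR R (by simp)
    cases R with
    | nil => simp at hl
    | cons x R =>
      have hl' : R.length = P.length := by simpa using hl
      by_cases hx : x = 0
      · subst hx
        refine ⟨fun i => Nat.casesOn i (a * g 0) g', ?_, ?_⟩
        · intro j
          have : redRow a P (0 :: R) = R := rfl
          simp only [List.map_cons, rowSum, this, h1]
          simp
          ring
        · intro h i hi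
          cases i with
          | zero =>
            have := h 0 (by simp)
            simpa [ha] using this
          | succ i =>
            refine h2 (fun i hi => ?_) i (by simpa using hi)
            exact h (i + 1) (by simpa using hi)
      · refine ⟨fun i => Nat.casesOn i (g 0) g', ?_, ?_⟩
        · intro j
          have : redRow a P (x :: R) = comb a (pr - x % pr) R P := by
            have : Nat.beq x 0 = false := by
              cases h : Nat.beq x 0
              · rfl
              · exact absurd (Nat.eq_of_beq_eq_true h) hx
            simp only [redRow, this]
            rfl
          have hs : (((pr - x % pr : ℕ)) : ZMod pr) = - (x : ZMod pr) := by
            rw [Nat.cast_sub (Nat.mod_lt _ (by norm_num)).le, ZMod.natCast_mod,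
              show ((pr : ℕ) : ZMod pr) = 0 from ZMod.natCast_self pr, zero_sub]
          simp only [List.map_cons, rowSum, this, h1, comb_getD _ _ _ _ hl', hs]
          simp
          ring
        · intro h i hi
          cases i with
          | zero => exact h 0 (by simp)
          | succ i =>
            refine h2 (fun i hi => ?_) i (by simpa using hi)
            exact h (i + 1) (by simpa using hi)

theorem gauss_sound : ∀ (n : ℕ) (k : ℕ) (rows : List (List ℕ)), gauss n rows = true →
    (∀ R ∈ rows, R.length = k) → ∀ g : ℕ → ZMod pr, (∀ j, rowSum g rows j = 0) →
    ∀ i < rows.length, g i = 0 := by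
  intro n
  induction n with
  | zero =>
    intro k rows h
    cases rows with
    | nil => simp
    | cons R Rs => simp [gauss] at h
  | succ n ih =>
    intro k rows h hk g hg
    match rows, h, hk, hg with
    | [], _, _, _ => simp
    | [] :: Rs, h, _, _ => simp [gauss] at h
    | (a :: P) :: Rs, h, hk, hg =>
      rw [gauss, forceRows_eq] at h
      simp only [Bool.and_eq_true, Bool.not_eq_true'] at h
      obtain ⟨h0, h1⟩ := h
      have ha : (a : ZMod pr) ≠ 0 := by
        intro h
        rw [ZMod.natCast_eq_zero_iff] at h
        have h2 : Nat.mod a pr = 0 := Nat.mod_eq_zero_of_dvd h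
        rw [h2] at h0
        exact absurd h0 (by decide)
      have hP : k = P.length + 1 := by
        have := hk (a :: P) (by simp)
        simpa using this.symm
      have hRs : ∀ R ∈ Rs, R.length = P.length + 1 := fun R hR => by
        rw [← hP]; exact hk R (by simp [hR])
      obtain ⟨g', hg1, hg2⟩ := rowSum_red a ha P Rs (fun i => g (i + 1)) hRs
      have hhead := hg 0
      simp only [rowSum, List.getD_cons_zero] at hhead
      have hz := ih P.length (Rs.map (redRow a P)) h1 (by
        intro R hR
        obtain ⟨R', hR', rfl⟩ := List.mem_map.1 hR
        exact redRow_length _ _ _ (hRs R' hR')) g' (by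
        intro j
        have hj := hg (j + 1)
        simp only [rowSum, List.getD_cons_succ] at hj
        rw [hg1]
        linear_combination (a : ZMod pr) * hj - ((P.getD j 0 : ℕ) : ZMod pr) * hhead)
      have hz' := hg2 (by simpa using hz)
      have hsum : ∀ (Rs : List (List ℕ)) (g : ℕ → ZMod pr), (∀ i < Rs.length, g i = 0) →
          ∀ j, rowSum g Rs j = 0 := by
        intro Rs
        induction Rs with
        | nil => intros; rfl
        | cons R Rs ih =>
          intro g h j
          simp only [rowSum]
          rw [h 0 (by simp), ih (fun i => g (i + 1)) (fun i hi => h (i + 1) (by simpa using hi))]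
          simp
      rw [hsum Rs _ hz'] at hhead
      intro i hi
      cases i with
      | zero => simpa [ha] using hhead
      | succ i => exact hz' i (by simpa using hi)

theorem rowSum_eq (rows : List (List ℕ)) : ∀ (g : ℕ → ZMod pr) (j : ℕ), rowSum g rows j
    = ∑ i ∈ Finset.range rows.length, g i * (((rows.getD i []).getD j 0 : ℕ) : ZMod pr) := by
  induction rows with
  | nil => intros; rfl
  | cons R Rs ih =>
    intro g j
    rw [rowSum, ih, List.length_cons, Finset.sum_range_succ']
    simp [add_comm]

/-- Values of the basic functions at the points of a list, as rational vectors. -/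
def vec (m : ℕ) (S : List Pt) (i : Fin S.length) : Fin (nus m).length → ℚ :=
  fun j => (fal (S.get i) ((nus m).get j) : ℚ)

theorem int_dvd (m : ℕ) (S : List Pt) (h : gauss 20 (S.map (bas m)) = true) (n : ℕ) :
    ∀ g : Fin S.length → ℤ, (∀ j : Fin (nus m).length,
      ∑ i, g i * (fal (S.get i) ((nus m).get j) : ℤ) = 0) → ∀ i, (pr : ℤ) ^ n ∣ g i := by
  induction n with
  | zero => intro g _ i; simp
  | succ n ih =>
    intro g hg i
    have hd : ∀ i, (pr : ℤ) ∣ g i := by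
      intro i
      have := gauss_sound 20 (nus m).length (S.map (bas m)) h (by
        intro R hR
        obtain ⟨s, _, rfl⟩ := List.mem_map.1 hR
        simp [bas]) (fun i => if hi : i < S.length then ((g ⟨i, hi⟩ : ℤ) : ZMod pr) else 0) (by
        intro j
        rw [rowSum_eq, List.length_map, Finset.sum_range]
        by_cases hj : j < (nus m).length
        · have h1 := congrArg (fun x : ℤ => (x : ZMod pr)) (hg ⟨j, hj⟩)
          simp only [Int.cast_zero, Int.cast_sum, Int.cast_mul, Int.cast_natCast] at h1
          rw [← h1]
          refine Finset.sum_congr rfl fun i _ => ?_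
          simp [bas, hj]
        · refine Finset.sum_eq_zero fun i _ => ?_
          simp [bas, hj]) i (by simp)
      simp only [Fin.is_lt, dite_true] at this
      exact (ZMod.intCast_zmod_eq_zero_iff_dvd _ _).1 this
    choose g' hg' using hd
    have hrel : ∀ j : Fin (nus m).length,
        ∑ i, g' i * (fal (S.get i) ((nus m).get j) : ℤ) = 0 := by
      intro j
      have h1 := hg j
      simp only [hg', mul_assoc] at h1
      rw [← Finset.mul_sum] at h1
      exact (mul_eq_zero.1 h1).resolve_left (by norm_num)
    rw [hg' i, pow_succ']
    exact mul_dvd_mul_left _ (ih g' hrel i)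

theorem vec_indep (m : ℕ) (S : List Pt) (h : gauss 20 (S.map (bas m)) = true) :
    LinearIndependent ℚ (vec m S) := by
  rw [← LinearIndependent.iff_fractionRing ℤ ℚ, Fintype.linearIndependent_iff]
  intro g hg i
  have hrel : ∀ j : Fin (nus m).length,
      ∑ i, g i * (fal (S.get i) ((nus m).get j) : ℤ) = 0 := by
    intro j
    have := congrFun hg j
    rw [Finset.sum_apply] at this
    simp only [Pi.smul_apply, vec, Pi.zero_apply] at this
    simp only [zsmul_eq_mul] at this
    exact_mod_cast this
  by_contra hne
  have hd := int_dvd m S h (g i).natAbs g hrel i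
  have h1 := Int.natAbs_dvd_natAbs.2 hd
  rw [Int.natAbs_pow] at h1
  have h2 := Nat.le_of_dvd (Int.natAbs_pos.2 hne) h1
  have h3 : (g i).natAbs < ((pr : ℤ).natAbs) ^ (g i).natAbs := Nat.lt_pow_self (by norm_num)
  omega

theorem exists_dual (m : ℕ) (S : List Pt) (h : gauss 20 (S.map (bas m)) = true) :
    ∃ q : Fin S.length → Fin (nus m).length → ℚ, ∀ i i',
      ∑ j, q i j * (fal (S.get i') ((nus m).get j) : ℚ) = if i = i' then 1 else 0 := by
  have hli := vec_indep m S h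
  obtain ⟨f, hf⟩ := LinearMap.exists_leftInverse_of_injective
    (Fintype.linearCombination ℚ (vec m S))
    (LinearMap.ker_eq_bot'.2 fun g hg => funext fun i =>
      Fintype.linearIndependent_iff.1 hli g (by simpa [Fintype.linearCombination_apply] using hg) i)
  refine ⟨fun i j => f (Pi.single j 1) i, fun i i' => ?_⟩
  have h1 : f (vec m S i') = Pi.single i' 1 := by
    have := LinearMap.congr_fun hf (Pi.single i' 1)
    simpa [Fintype.linearCombination_apply_single] using this
  have h2 : vec m S i' = ∑ j, vec m S i' j • (Pi.single j (1 : ℚ) : Fin (nus m).length → ℚ) := by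
    rw [← pi_eq_sum_univ']
  have h3 : f (vec m S i') i = ∑ j, vec m S i' j * f (Pi.single j 1) i := by
    conv_lhs => rw [h2]
    simp [map_sum, Finset.sum_apply]
  rw [h1] at h3
  rw [Pi.single_apply] at h3
  rw [h3]
  refine Finset.sum_congr rfl fun j _ => ?_
  rw [vec, mul_comm]


/-! ### The degeneration lemma -/

theorem exists_Q (m : ℕ) (S : List Pt) (h : gauss 20 (S.map (bas m)) = true) :
    ∃ q : Pt → Fin (nus m).length → ℚ, ∀ s ∈ S, ∀ s' ∈ S,
      ∑ j, q s j * (fal s' ((nus m).get j) : ℚ) = if s = s' then 1 else 0 := by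
  obtain ⟨q, hq⟩ := exists_dual m S h
  classical
  refine ⟨fun s => if hs : s ∈ S then q (List.get_of_mem hs).choose else 0, ?_⟩
  intro s hs s' hs'
  simp only [hs, dite_true]
  have h1 := (List.get_of_mem hs).choose_spec
  have h2 := (List.get_of_mem hs').choose_spec
  set i := (List.get_of_mem hs).choose
  by_cases hss : s = s'
  · subst hss
    have := hq i i
    rw [h1] at this
    simpa using this
  · set i' := (List.get_of_mem hs').choose
    have := hq i i'
    rw [h2, if_neg (fun hii => hss (by rw [← h1, ← h2, hii]))] at this
    rw [this, if_neg hss]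

/-- On a space of functions determined by their values on `S`, these values bound the others. -/
theorem exists_bound (D S : Finset Pt) (W : Submodule ℚ (Pt → ℚ))
    (hinj : ∀ c ∈ W, (∀ s ∈ S, c s = 0) → c = 0) :
    ∃ C : ℚ, 0 ≤ C ∧ ∀ c ∈ W, ∀ M : ℚ, (∀ s ∈ S, |c s| ≤ M) → ∀ v ∈ D, |c v| ≤ C * M := by
  let r : W →ₗ[ℚ] (S → ℚ) := LinearMap.pi fun s => LinearMap.proj (s : Pt) ∘ₗ W.subtype
  have hr : ∀ (c : W) (s : S), r c s = (c : Pt → ℚ) s := fun _ _ => rfl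
  obtain ⟨f, hf⟩ := LinearMap.exists_leftInverse_of_injective r (LinearMap.ker_eq_bot'.2 (by
    intro c hc
    refine Subtype.ext (hinj c c.2 fun s hs => ?_)
    rw [← hr c ⟨s, hs⟩, hc]
    rfl))
  refine ⟨∑ v ∈ D, ∑ s : S, |(f (Pi.single s 1) : Pt → ℚ) v|, by positivity, ?_⟩
  intro c hc M hM v hv
  by_cases hS : S.Nonempty
  · obtain ⟨s₀, hs₀⟩ := hS
    have hM0 : 0 ≤ M := (abs_nonneg _).trans (hM s₀ hs₀)
    have h1 : f (r ⟨c, hc⟩) = ⟨c, hc⟩ := LinearMap.congr_fun hf ⟨c, hc⟩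
    have h2 : r ⟨c, hc⟩ = ∑ s : S, c s • (Pi.single s (1 : ℚ) : S → ℚ) := by
      conv_lhs => rw [pi_eq_sum_univ' (r ⟨c, hc⟩)]
      rfl
    have h3 : c v = ∑ s : S, c s * (f (Pi.single s 1) : Pt → ℚ) v := by
      have := congrArg (fun x : W => (x : Pt → ℚ) v) h1
      simp only [h2, map_sum, map_smul] at this
      rw [← this]
      simp [Finset.sum_apply]
    calc |c v| ≤ ∑ s : S, |c s * (f (Pi.single s 1) : Pt → ℚ) v| := by
          rw [h3]; exact Finset.abs_sum_le_sum_abs _ _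
      _ ≤ ∑ s : S, M * |(f (Pi.single s 1) : Pt → ℚ) v| := by
          refine Finset.sum_le_sum fun s _ => ?_
          rw [abs_mul]
          exact mul_le_mul_of_nonneg_right (hM s s.2) (abs_nonneg _)
      _ = (∑ s : S, |(f (Pi.single s 1) : Pt → ℚ) v|) * M := by
          rw [← Finset.mul_sum, mul_comm]
      _ ≤ _ := by
          refine mul_le_mul_of_nonneg_right ?_ hM0
          exact Finset.single_le_sum
            (f := fun v => ∑ s : S, |(f (Pi.single s 1) : Pt → ℚ) v|)
            (fun _ _ => by positivity) hv
  · rw [Finset.not_nonempty_iff_eq_empty] at hS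
    subst hS
    have : c = 0 := hinj c hc (by simp)
    subst this
    have : IsEmpty (↥(∅ : Finset Pt)) := inferInstance
    simp

theorem core (S D' : Finset Pt) (W : Submodule ℚ (Pt → ℚ))
    (hinj : ∀ c ∈ W, (∀ s ∈ S, c s = 0) → c = 0) (ω : Pt → ℕ)
    (hω : ∀ s ∈ S, ∀ u ∈ D', ω s < ω u) (Q : Pt → Pt → ℚ)
    (hQ : ∀ s ∈ S, ∀ s' ∈ S, Q s s' = if s = s' then 1 else 0) :
    ∃ ε : ℚ, 0 < ε ∧ ∀ t : ℚ, 0 < t → t < ε → ∀ c ∈ W,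
      (∀ s ∈ S, ∑ v ∈ S ∪ D', c v * Q s v * t ^ ω v = 0) → c = 0 := by
  obtain ⟨C, hC, hb⟩ := exists_bound D' S W hinj
  set K : ℚ := ∑ s ∈ S, ∑ u ∈ D', |Q s u| with hK
  have hK0 : 0 ≤ K := by positivity
  refine ⟨min 1 (1 / (C * K + 1)), by positivity, ?_⟩
  intro t ht htε c hc heq
  have ht1 : t < 1 := htε.trans_le (min_le_left _ _)
  have ht2 : t * (C * K + 1) < 1 := by
    have := htε.trans_le (min_le_right _ _)
    rwa [lt_div_iff₀ (by positivity)] at this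
  refine hinj c hc ?_
  intro s₁ hs₁
  obtain ⟨s, hs, hmax⟩ := Finset.exists_max_image S (fun s => |c s|) ⟨s₁, hs₁⟩
  have hdis : Disjoint S D' := by
    rw [Finset.disjoint_left]
    intro v h1 h2
    exact lt_irrefl _ (hω v h1 v h2)
  have h1 := heq s hs
  rw [Finset.sum_union hdis, Finset.sum_eq_single s] at h1
  · rw [hQ s hs s hs, if_pos rfl] at h1
    have h2 : |c s| * t ^ ω s ≤ (C * K * t * |c s|) * t ^ ω s := by
      calc |c s| * t ^ ω s = |∑ u ∈ D', c u * Q s u * t ^ ω u| := by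
            have : c s * t ^ ω s = - ∑ u ∈ D', c u * Q s u * t ^ ω u := by linarith
            rw [← abs_neg (∑ u ∈ D', c u * Q s u * t ^ ω u), ← this, abs_mul,
              abs_of_pos (pow_pos ht _)]
        _ ≤ ∑ u ∈ D', |c u * Q s u * t ^ ω u| := Finset.abs_sum_le_sum_abs _ _
        _ ≤ ∑ u ∈ D', (C * |c s|) * |Q s u| * t ^ (ω s + 1) := by
            refine Finset.sum_le_sum fun u hu => ?_
            rw [abs_mul, abs_mul, abs_of_pos (pow_pos ht _)]
            have e1 := hb c hc |c s| hmax u hu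
            have e2 : t ^ ω u ≤ t ^ (ω s + 1) :=
              pow_le_pow_of_le_one ht.le ht1.le (hω s hs u hu)
            gcongr
        _ = (C * |c s|) * (∑ u ∈ D', |Q s u|) * t ^ (ω s + 1) := by
            rw [Finset.mul_sum, Finset.sum_mul]
        _ ≤ (C * |c s|) * K * t ^ (ω s + 1) := by
            have : ∑ u ∈ D', |Q s u| ≤ K :=
              Finset.single_le_sum (f := fun s => ∑ u ∈ D', |Q s u|)
                (fun _ _ => by positivity) hs
            gcongr
        _ = _ := by ring
    have h3 : |c s| ≤ C * K * t * |c s| := le_of_mul_le_mul_right h2 (pow_pos ht _)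
    have h4 : |c s| ≤ 0 := by
      have h5 : 0 ≤ |c s| := abs_nonneg _
      by_contra hne
      push Not at hne
      nlinarith
    exact abs_nonpos_iff.1 ((hmax s₁ hs₁).trans h4)
  · intro s' hs' hne
    rw [hQ s hs s' hs', if_neg (Ne.symm hne)]
    ring
  · exact fun h => absurd hs h

/-- The value of a monomial at a point. -/
def ev (p : Fin 4 → ℚ) (v : Pt) : ℚ :=
  p 0 ^ v.1 * p 1 ^ v.2.1 * p 2 ^ v.2.2.1 * p 3 ^ v.2.2.2

/-- The conditions imposed by a point of multiplicity `m` on a coefficient function. -/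
def Cond (m : ℕ) (p : Fin 4 → ℚ) (D : Finset Pt) (c : Pt → ℚ) : Prop :=
  ∀ n ∈ nus m, ∑ v ∈ D, c v * (fal v n : ℚ) * ev p v = 0

/-- The exponent set `D` admits no nonzero polynomial vanishing at the listed points. -/
def Kills (D : Finset Pt) (P : List (ℕ × (Fin 4 → ℚ))) : Prop :=
  ∀ c : Pt → ℚ, (∀ x ∈ P, Cond x.1 x.2 D c) → ∀ v ∈ D, c v = 0

/-- Two points are linearly independent. -/
def Ind (p q : Fin 4 → ℚ) : Prop := LinearIndependent ℚ ![p, q]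

theorem Ind_symm {p q : Fin 4 → ℚ} (h : Ind p q) : Ind q p :=
  LinearIndependent.pair_symm_iff.1 h

theorem Ind_of_ne (p q : Fin 4 → ℚ) (a b : Fin 4) (h : p b * q a ≠ q b * p a) : Ind p q := by
  rw [Ind, LinearIndependent.pair_iff]
  intro s t hst
  have h1 := congrFun hst a
  have h2 := congrFun hst b
  simp only [Pi.add_apply, Pi.smul_apply, smul_eq_mul, Pi.zero_apply] at h1 h2
  have h3 : p b * q a - q b * p a ≠ 0 := sub_ne_zero.2 h
  constructor
  · refine (mul_eq_zero.1 (?_ : s * (p b * q a - q b * p a) = 0)).resolve_right h3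
    linear_combination q a * h2 - q b * h1
  · refine (mul_eq_zero.1 (?_ : t * (p b * q a - q b * p a) = 0)).resolve_right h3
    linear_combination p b * h1 - p a * h2

/-- The point `(t^w₀, t^w₁, t^w₂, t^w₃)`. -/
def curve (w : Pt) (t : ℚ) : Fin 4 → ℚ := ![t ^ w.1, t ^ w.2.1, t ^ w.2.2.1, t ^ w.2.2.2]

/-- The coordinates of a weight vector. -/
def wc (w : Pt) : Fin 4 → ℕ := ![w.1, w.2.1, w.2.2.1, w.2.2.2]

theorem curve_apply (w : Pt) (t : ℚ) (i : Fin 4) : curve w t i = t ^ wc w i := by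
  fin_cases i <;> rfl

theorem ev_curve (w : Pt) (t : ℚ) (v : Pt) : ev (curve w t) v = t ^ wt w v := by
  change (t ^ w.1) ^ v.1 * (t ^ w.2.1) ^ v.2.1 * (t ^ w.2.2.1) ^ v.2.2.1
    * (t ^ w.2.2.2) ^ v.2.2.2 = t ^ (w.1 * v.1 + (w.2.1 * v.2.1 + (w.2.2.1 * v.2.2.1
      + w.2.2.2 * v.2.2.2)))
  simp only [pow_add, pow_mul]
  ring

theorem exists_lt_of_nonconst (w : Pt) (h : nonconst w = true) :
    ∃ a b : Fin 4, wc w a < wc w b := by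
  by_contra hcon
  push Not at hcon
  obtain ⟨x, y, z, u⟩ := w
  have h1 : x = y := le_antisymm (hcon 1 0) (hcon 0 1)
  have h2 : y = z := le_antisymm (hcon 2 1) (hcon 1 2)
  have h3 : z = u := le_antisymm (hcon 3 2) (hcon 2 3)
  subst h1 h2 h3
  simp [nonconst] at h

theorem exists_small (L : List (Fin 4 → ℚ)) (hL : ∀ p ∈ L, ∀ i, 0 < p i) (a b : Fin 4) :
    ∃ δ : ℚ, 0 < δ ∧ ∀ p ∈ L, δ ≤ p b / p a := by
  induction L with
  | nil => exact ⟨1, one_pos, by simp⟩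
  | cons q L ih =>
    obtain ⟨δ, h0, h1⟩ := ih fun p hp => hL p (by simp [hp])
    refine ⟨min δ (q b / q a), lt_min h0 (div_pos (hL q (by simp) b) (hL q (by simp) a)), ?_⟩
    intro p hp
    rcases List.mem_cons.1 hp with rfl | hp
    · exact min_le_right _ _
    · exact (min_le_left _ _).trans (h1 p hp)

/-- Adding a point: the combinatorial check gives a new point and a bigger exponent set. -/
theorem add_point (m : ℕ) (w : Pt) (th : ℕ) (S : List Pt) (D' : Finset Pt)
    (P : List (ℕ × (Fin 4 → ℚ))) (hP : ∀ x ∈ P, ∀ i, 0 < x.2 i)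
    (hK : Kills D' P) (hw : nonconst w = true) (hS : ∀ v ∈ S, wt w v ≤ th)
    (hD : ∀ v ∈ D', th < wt w v) (hg : gauss 20 (S.map (bas m)) = true) :
    ∃ p : Fin 4 → ℚ, (∀ i, 0 < p i) ∧ (∀ x ∈ P, Ind p x.2) ∧
      Kills (S.toFinset ∪ D') ((m, p) :: P) := by
  obtain ⟨q, hq⟩ := exists_Q m S hg
  let W : Submodule ℚ (Pt → ℚ) :=
    { carrier := {c | (∀ v ∉ S.toFinset ∪ D', c v = 0) ∧
        ∀ x ∈ P, Cond x.1 x.2 (S.toFinset ∪ D') c}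
      add_mem' := by
        rintro c c' ⟨h1, h2⟩ ⟨h1', h2'⟩
        refine ⟨fun v hv => by simp [h1 v hv, h1' v hv], fun x hx n hn => ?_⟩
        have e1 := h2 x hx n hn
        have e2 := h2' x hx n hn
        simp only [Pi.add_apply, add_mul, Finset.sum_add_distrib, e1, e2, add_zero]
      zero_mem' := ⟨fun _ _ => rfl, fun x _ n _ => by simp⟩
      smul_mem' := by
        rintro r c ⟨h1, h2⟩
        refine ⟨fun v hv => by simp [h1 v hv], fun x hx n hn => ?_⟩
        have e1 := h2 x hx n hn
        simp only [Pi.smul_apply, smul_eq_mul, mul_assoc] at e1 ⊢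
        rw [← Finset.mul_sum, e1, mul_zero] }
  have hdis : Disjoint S.toFinset D' := by
    rw [Finset.disjoint_left]
    intro v h1 h2
    have e1 := hS v (by simpa using h1)
    have e2 := hD v h2
    omega
  have hinj : ∀ c ∈ W, (∀ s ∈ S.toFinset, c s = 0) → c = 0 := by
    rintro c ⟨h1, h2⟩ h3
    have h4 : ∀ v ∈ D', c v = 0 := by
      refine hK c fun x hx n hn => ?_
      have e1 := h2 x hx n hn
      rw [Finset.sum_union hdis, Finset.sum_eq_zero, zero_add] at e1
      · exact e1
      · intro v hv
        rw [h3 v hv]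
        ring
    funext v
    by_cases hv : v ∈ S.toFinset ∪ D'
    · rcases Finset.mem_union.1 hv with hv | hv
      · exact h3 v hv
      · exact h4 v hv
    · exact h1 v hv
  obtain ⟨ε, hε, hcore⟩ := core S.toFinset D' W hinj (wt w)
    (fun s hs u hu => (hS s (by simpa using hs)).trans_lt (hD u hu))
    (fun s v => ∑ j, q s j * (fal v ((nus m).get j) : ℚ))
    (fun s hs s' hs' => hq s (by simpa using hs) s' (by simpa using hs'))
  obtain ⟨a, b, hab⟩ := exists_lt_of_nonconst w hw
  obtain ⟨δ, hδ, hsmall⟩ := exists_small (P.map Prod.snd) (by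
    intro p hp
    obtain ⟨x, hx, rfl⟩ := List.mem_map.1 hp
    exact hP x hx) a b
  obtain ⟨t, ht0, ht⟩ := exists_between (lt_min hε (lt_min hδ one_pos))
  have ht1 : t < ε := ht.trans_le (min_le_left _ _)
  have ht2 : t < δ := ht.trans_le ((min_le_right _ _).trans (min_le_left _ _))
  have ht3 : t < 1 := ht.trans_le ((min_le_right _ _).trans (min_le_right _ _))
  refine ⟨curve w t, fun i => ?_, ?_, ?_⟩
  · rw [curve_apply]; exact pow_pos ht0 _
  · intro x hx
    refine Ind_of_ne _ _ a b (ne_of_lt ?_)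
    have h1 := hsmall x.2 (List.mem_map.2 ⟨x, hx, rfl⟩)
    have ha := hP x hx a
    have hb := hP x hx b
    rw [le_div_iff₀ ha] at h1
    rw [curve_apply, curve_apply]
    have h2 : t ^ wc w b ≤ t ^ (wc w a + 1) := pow_le_pow_of_le_one ht0.le ht3.le hab
    have h3 : 0 < t ^ wc w a := pow_pos ht0 _
    calc t ^ wc w b * x.2 a ≤ t ^ (wc w a + 1) * x.2 a := by gcongr
      _ = (t * x.2 a) * t ^ wc w a := by ring
      _ < (δ * x.2 a) * t ^ wc w a := by gcongr
      _ ≤ x.2 b * t ^ wc w a := by gcongr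
  · intro c hc
    set D := S.toFinset ∪ D'
    let c' : Pt → ℚ := fun v => if v ∈ D then c v else 0
    have hcond : ∀ (k : ℕ) (p : Fin 4 → ℚ), Cond k p D c → Cond k p D c' := by
      intro k p h n hn
      rw [← h n hn]
      refine Finset.sum_congr rfl fun v hv => ?_
      simp only [c', hv, if_true]
    have hW : c' ∈ W := by
      refine ⟨fun v hv => if_neg hv, fun x hx => ?_⟩
      exact hcond _ _ (hc x (by simp [hx]))
    have hpt := hcond _ _ (hc (m, curve w t) (by simp))
    have h0 : c' = 0 := by
      refine hcore t ht0 ht1 c' hW fun s hs => ?_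
      have : ∀ v, c' v * (∑ j, q s j * (fal v ((nus m).get j) : ℚ)) * t ^ wt w v
          = ∑ j, q s j * (c' v * (fal v ((nus m).get j) : ℚ) * ev (curve w t) v) := by
        intro v
        rw [ev_curve, Finset.mul_sum, Finset.sum_mul]
        exact Finset.sum_congr rfl fun j _ => by ring
      simp only [this]
      rw [Finset.sum_comm]
      refine Finset.sum_eq_zero fun j _ => ?_
      rw [← Finset.mul_sum, hpt _ (List.get_mem _ _), mul_zero]
    intro v hv
    have := congrFun h0 v
    simpa only [c', hv, if_true, Pi.zero_apply] using this

/-! ### Soundness of the chain checker -/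

/-- `D` is killed by `a` quadruple points and `b` triple points in general position. -/
def Solv (D : Finset Pt) (a b : ℕ) : Prop :=
  ∃ P4 P3 : List (Fin 4 → ℚ), P4.length = a ∧ P3.length = b ∧
    (∀ p ∈ P4 ++ P3, ∀ i, 0 < p i) ∧ (P4 ++ P3).Pairwise Ind ∧
    Kills D (P4.map (fun p => (4, p)) ++ P3.map (fun p => (3, p)))

theorem Kills_mono {D : Finset Pt} {P P' : List (ℕ × (Fin 4 → ℚ))} (h : Kills D P)
    (hPP : ∀ x ∈ P, x ∈ P') : Kills D P' :=
  fun c hc => h c fun x hx => hc x (hPP x hx)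

theorem mem_pairs {P4 P3 : List (Fin 4 → ℚ)} {x : ℕ × (Fin 4 → ℚ)}
    (hx : x ∈ P4.map (fun p => (4, p)) ++ P3.map (fun p => (3, p))) : x.2 ∈ P4 ++ P3 := by
  simp only [List.mem_append, List.mem_map] at hx ⊢
  rcases hx with ⟨p, hp, rfl⟩ | ⟨p, hp, rfl⟩
  · exact Or.inl hp
  · exact Or.inr hp

theorem mem_pairs_of {P4 P3 : List (Fin 4 → ℚ)} {p : Fin 4 → ℚ} (hp : p ∈ P4 ++ P3) :
    ∃ x ∈ P4.map (fun p => (4, p)) ++ P3.map (fun p => (3, p)), x.2 = p := by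
  rcases List.mem_append.1 hp with hp | hp
  · exact ⟨(4, p), by simp [hp], rfl⟩
  · exact ⟨(3, p), by simp [hp], rfl⟩

/-- The exponents in a list of groups. -/
def expo (L : List (List Pt)) : Finset Pt := L.flatten.toFinset

theorem mem_expo {L : List (List Pt)} {v : Pt} : v ∈ expo L ↔ ∃ l ∈ L, v ∈ l := by
  simp [expo]

theorem expo_cons (S : List Pt) (L : List (List Pt)) : expo (S :: L) = S.toFinset ∪ expo L := by
  simp [expo]

theorem checkStep_spec {m : ℕ} {s : Step} {L : List (List Pt)} (h : checkStep m s L = true) :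
    nonconst s.w = true ∧ (∀ v ∈ s.S, wt s.w v ≤ s.th) ∧ (∀ v ∈ expo L, s.th < wt s.w v) ∧
      gauss 20 (s.S.map (bas m)) = true := by
  rw [checkStep, forceRows_eq] at h
  simp only [Bool.and_eq_true, List.all_eq_true] at h
  obtain ⟨h1, h2, h3, h4⟩ := h
  refine ⟨h1, fun v hv => Nat.le_of_ble_eq_true (h2 v hv), fun v hv => ?_, h4⟩
  obtain ⟨l, hl, hv⟩ := mem_expo.1 hv
  have := h3 l hl
  rw [above, List.all_eq_true] at this
  exact Nat.le_of_ble_eq_true (this v hv)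

theorem step4 {s : Step} {L : List (List Pt)} {a b : ℕ} (h : checkStep 4 s L = true)
    (hs : Solv (expo L) a b) : Solv (expo (s.S :: L)) (a + 1) b := by
  obtain ⟨h1, h2, h3, h4⟩ := checkStep_spec h
  obtain ⟨P4, P3, l4, l3, hpos, hpw, hk⟩ := hs
  obtain ⟨p, hp, hi, hk'⟩ := add_point 4 s.w s.th s.S (expo L) _
    (fun x hx => hpos x.2 (mem_pairs hx)) hk h1 h2 h3 h4
  refine ⟨p :: P4, P3, by simp [l4], l3, ?_, ?_, ?_⟩
  · intro q hq
    rw [List.cons_append, List.mem_cons] at hq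
    rcases hq with rfl | hq
    · exact hp
    · exact hpos q hq
  · rw [List.cons_append, List.pairwise_cons]
    refine ⟨fun q hq => ?_, hpw⟩
    obtain ⟨x, hx, rfl⟩ := mem_pairs_of hq
    exact hi x hx
  · rw [expo_cons]
    exact hk'

theorem step3 {s : Step} {L : List (List Pt)} {a b : ℕ} (h : checkStep 3 s L = true)
    (hs : Solv (expo L) a b) : Solv (expo (s.S :: L)) a (b + 1) := by
  obtain ⟨h1, h2, h3, h4⟩ := checkStep_spec h
  obtain ⟨P4, P3, l4, l3, hpos, hpw, hk⟩ := hs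
  obtain ⟨p, hp, hi, hk'⟩ := add_point 3 s.w s.th s.S (expo L) _
    (fun x hx => hpos x.2 (mem_pairs hx)) hk h1 h2 h3 h4
  have hperm : (P4 ++ p :: P3).Perm (p :: (P4 ++ P3)) := List.perm_middle
  refine ⟨P4, p :: P3, l4, by simp [l3], ?_, ?_, ?_⟩
  · intro q hq
    have hq := hperm.mem_iff.1 hq
    rw [List.mem_cons] at hq
    rcases hq with rfl | hq
    · exact hp
    · exact hpos q hq
  · rw [hperm.pairwise_iff (fun h => Ind_symm h), List.pairwise_cons]
    refine ⟨fun q hq => ?_, hpw⟩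
    obtain ⟨x, hx, rfl⟩ := mem_pairs_of hq
    exact hi x hx
  · rw [expo_cons]
    refine Kills_mono hk' fun x hx => ?_
    simp only [List.mem_cons, List.mem_append, List.map_cons] at hx ⊢
    tauto

/-- Exponents of a chain followed by those of `L`. -/
def stack (ss : List Step) (L : List (List Pt)) : List (List Pt) :=
  ss.foldr (fun t M => t.S :: M) L

theorem chain4 {L : List (List Pt)} {a b : ℕ} (hs : Solv (expo L) a b) : ∀ ss : List Step,
    checkChain 4 ss L = true → Solv (expo (stack ss L)) (a + ss.length) b := by
  intro ss
  induction ss with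
  | nil => intro _; exact hs
  | cons s ss ih =>
    intro h
    rw [checkChain, Bool.and_eq_true] at h
    exact step4 h.1 (ih h.2)

theorem chain3 {L : List (List Pt)} {a b : ℕ} (hs : Solv (expo L) a b) : ∀ ss : List Step,
    checkChain 3 ss L = true → Solv (expo (stack ss L)) a (b + ss.length) := by
  intro ss
  induction ss with
  | nil => intro _; exact hs
  | cons s ss ih =>
    intro h
    rw [checkChain, Bool.and_eq_true] at h
    exact step3 h.1 (ih h.2)

theorem mem_stack {ss : List Step} {L : List (List Pt)} {v : Pt} :
    v ∈ expo (stack ss L) ↔ (∃ s ∈ ss, v ∈ s.S) ∨ v ∈ expo L := by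
  induction ss with
  | nil => simp [stack]
  | cons s ss ih =>
    change v ∈ expo (s.S :: stack ss L) ↔ _
    rw [expo_cons, Finset.mem_union, ih]
    simp [or_assoc]

theorem ptEq_eq {u v : Pt} (h : ptEq u v = true) : u = v := by
  obtain ⟨a, b, c, d⟩ := u
  obtain ⟨i, j, k, l⟩ := v
  simp only [ptEq, Bool.and_eq_true] at h
  obtain ⟨h1, h2, h3, h4⟩ := h
  rw [Nat.eq_of_beq_eq_true h1, Nat.eq_of_beq_eq_true h2, Nat.eq_of_beq_eq_true h3,
    Nat.eq_of_beq_eq_true h4]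

theorem subPts_spec {A B : List Step} (h : subPts A B = true) {v : Pt}
    (hv : ∃ s ∈ A, v ∈ s.S) : ∃ s ∈ B, v ∈ s.S := by
  obtain ⟨s, hs, hv⟩ := hv
  simp only [subPts, List.all_eq_true, List.any_eq_true] at h
  obtain ⟨b, hb, u, hu, he⟩ := h s hs v hv
  exact ⟨b, hb, ptEq_eq he ▸ hu⟩

theorem block_q {B : Blk} {Bs : List Blk} {a b : ℕ} (h : checkBlk B (groups Bs) = true)
    (hs : Solv (expo (groups Bs)) a b) : Solv (expo (groups (B :: Bs))) (a + B.q.length) b := by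
  simp only [checkBlk, Bool.and_eq_true] at h
  exact chain4 hs B.q h.1

theorem block_t {B : Blk} {Bs : List Blk} {a b : ℕ} (h : checkBlk B (groups Bs) = true)
    (hs : Solv (expo (groups Bs)) a b) : Solv (expo (groups (B :: Bs))) a (b + B.t.length) := by
  simp only [checkBlk, Bool.and_eq_true] at h
  have h1 := chain3 hs B.t h.2.1
  have h2 : expo (groups (B :: Bs)) = expo (stack B.t (groups Bs)) := by
    ext v
    change v ∈ expo (stack B.q (groups Bs)) ↔ _
    rw [mem_stack, mem_stack]
    exact or_congr_left ⟨subPts_spec h.2.2.1, subPts_spec h.2.2.2⟩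
  rw [h2]
  exact h1

theorem solv_nil : Solv (expo (groups [])) 0 0 :=
  ⟨[], [], rfl, rfl, by simp, by simp, fun _ _ v hv => by simp [expo, groups] at hv⟩

theorem flex : ∀ Bs : List Blk, checkAll Bs = true →
    (∀ B ∈ Bs, B.q.length = 1 ∧ B.t.length = 2) → ∀ a ≤ Bs.length,
    Solv (expo (groups Bs)) a (2 * (Bs.length - a)) := by
  intro Bs
  induction Bs with
  | nil =>
    intro _ _ a ha
    obtain rfl : a = 0 := by simpa using ha
    exact solv_nil
  | cons B Bs ih =>
    intro h hl a ha
    rw [checkAll, Bool.and_eq_true] at h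
    have hB := hl B (by simp)
    have ih := ih h.2 fun B' hB' => hl B' (by simp [hB'])
    rw [List.length_cons] at ha ⊢
    by_cases ha' : a ≤ Bs.length
    · have h1 := block_t h.1 (ih a ha')
      rw [hB.2] at h1
      have : 2 * (Bs.length + 1 - a) = 2 * (Bs.length - a) + 2 := by omega
      rw [this]
      exact h1
    · obtain rfl : a = Bs.length + 1 := by omega
      have h1 := block_q h.1 (ih Bs.length le_rfl)
      rw [hB.1] at h1
      simpa using h1

theorem solv_q {Cs : List Blk} {a b : ℕ} (hs : Solv (expo (groups Cs)) a b) : ∀ Bs : List Blk,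
    checkAll (Bs ++ Cs) = true →
    Solv (expo (groups (Bs ++ Cs))) (a + (Bs.map fun B => B.q.length).sum) b := by
  intro Bs
  induction Bs with
  | nil => intro _; exact hs
  | cons B Bs ih =>
    intro h
    rw [List.cons_append, checkAll, Bool.and_eq_true] at h
    have h1 := block_q h.1 (ih h.2)
    rw [List.map_cons, List.sum_cons, add_comm B.q.length, ← add_assoc]
    exact h1

theorem solv_t {Cs : List Blk} {a b : ℕ} (hs : Solv (expo (groups Cs)) a b) : ∀ Bs : List Blk,
    checkAll (Bs ++ Cs) = true →
    Solv (expo (groups (Bs ++ Cs))) a (b + (Bs.map fun B => B.t.length).sum) := by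
  intro Bs
  induction Bs with
  | nil => intro _; exact hs
  | cons B Bs ih =>
    intro h
    rw [List.cons_append, checkAll, Bool.and_eq_true] at h
    have h1 := block_t h.1 (ih h.2)
    rw [List.map_cons, List.sum_cons, add_comm B.t.length, ← add_assoc]
    exact h1

theorem checkAll_split {Bs Cs : List Blk} (h : checkAll (Bs ++ Cs) = true) :
    checkAll Cs = true := by
  induction Bs with
  | nil => exact h
  | cons B Bs ih =>
    rw [List.cons_append, checkAll, Bool.and_eq_true] at h
    exact ih h.2

theorem solv_all (Bs Cs : List Blk) (h : checkAll (Bs ++ Cs) = true)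
    (hl : ∀ B ∈ Cs, B.q.length = 1 ∧ B.t.length = 2) (hC : Cs.length = 61)
    (hq : (Bs.map fun B => B.q.length).sum = 16) (ht : (Bs.map fun B => B.t.length).sum = 32)
    (a b : ℕ) (hab : 2 * a + b = 154) : Solv (expo (groups (Bs ++ Cs))) a b := by
  have hf := flex Cs (checkAll_split h) hl
  rw [hC] at hf
  by_cases ha : 16 ≤ a
  · have h1 := solv_q (hf (a - 16) (by omega)) Bs h
    rw [hq] at h1
    have e1 : a - 16 + 16 = a := by omega
    have e2 : 2 * (61 - (a - 16)) = b := by omega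
    rwa [e1, e2] at h1
  · have h1 := solv_t (hf a (by omega)) Bs h
    rw [ht] at h1
    have e2 : 2 * (61 - a) + 32 = b := by omega
    rwa [e2] at h1

theorem checkAll_cons {B : Blk} {Bs : List Blk} (h : checkBlk B (groups Bs) = true)
    (h' : checkAll Bs = true) : checkAll (B :: Bs) = true := by
  rw [checkAll, h, h', Bool.and_self]

/-! ### Coverage -/

theorem maskL_spec (k : ℕ → Bool) : ∀ (L : List Pt) (acc : ℕ), maskL L acc k = true →
    (∀ v ∈ L, v.1 + (v.2.1 + (v.2.2.1 + v.2.2.2)) = 19) ∧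
    ∃ M, k M = true ∧ ∀ j, Nat.testBit M j = true →
      Nat.testBit acc j = true ∨ ∃ v ∈ L, code v = j := by
  intro L
  induction L with
  | nil => intro acc h; exact ⟨by simp, acc, h, fun j hj => Or.inl hj⟩
  | cons v vs ih =>
    intro acc h
    rw [maskL, forceNat_eq, Bool.and_eq_true] at h
    obtain ⟨h1, M, hM, h2⟩ := ih _ h.2
    refine ⟨?_, M, hM, fun j hj => ?_⟩
    · intro u hu
      rcases List.mem_cons.1 hu with rfl | hu
      · exact Nat.eq_of_beq_eq_true h.1
      · exact h1 u hu
    · rcases h2 j hj with h3 | ⟨u, hu, rfl⟩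
      · change Nat.testBit (acc ||| 1 <<< code v) j = true at h3
        rw [Nat.testBit_or, Bool.or_eq_true] at h3
        rcases h3 with h3 | h3
        · exact Or.inl h3
        · refine Or.inr ⟨v, by simp, ?_⟩
          rw [Nat.one_shiftLeft, Nat.testBit_two_pow] at h3
          simpa using h3
      · exact Or.inr ⟨u, by simp [hu], rfl⟩

theorem covers_spec {L : List (List Pt)} (h : covers L = true) (v : Pt) :
    v ∈ expo L ↔ v.1 + (v.2.1 + (v.2.2.1 + v.2.2.2)) = 19 := by
  obtain ⟨h1, M, hM, h2⟩ := maskL_spec _ _ _ h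
  constructor
  · intro hv
    exact h1 v (by simpa [expo] using hv)
  · intro hv
    obtain ⟨i, j, k, l⟩ := v
    simp only at hv
    simp only [List.all_eq_true, List.mem_range, Bool.or_eq_true] at hM
    have h3 := hM i (by omega) j (by omega) k (by omega)
    rcases h3 with h3 | h3
    · have := Nat.le_of_ble_eq_true h3
      omega
    · rcases h2 _ h3 with h4 | ⟨u, hu, hc⟩
      · simp at h4
      · have hu' := h1 u hu
        obtain ⟨i', j', k', l'⟩ := u
        simp only at hu'
        change 400 * i' + (20 * j' + k') = 400 * i + (20 * j + k) at hc
        obtain rfl : i' = i := by omega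
        obtain rfl : j' = j := by omega
        obtain rfl : k' = k := by omega
        obtain rfl : l' = l := by omega
        simpa [expo] using hu

/-! ### From coefficients to polynomials -/

/-- The exponent vector as a finitely supported function. -/
noncomputable def tof (v : Pt) : Fin 4 →₀ ℕ :=
  Finsupp.equivFunOnFinite.symm ![v.1, v.2.1, v.2.2.1, v.2.2.2]

/-- The inverse of `tof`. -/
def oft (s : Fin 4 →₀ ℕ) : Pt := (s 0, s 1, s 2, s 3)

theorem tof_oft (s : Fin 4 →₀ ℕ) : tof (oft s) = s := by
  ext i
  fin_cases i <;> rfl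

theorem oft_tof (v : Pt) : oft (tof v) = v := rfl

theorem pderiv_pow_monomial (i : Fin 4) (s : Fin 4 →₀ ℕ) (r : ℚ) : ∀ k : ℕ,
    ((pderiv i).toLinearMap ^ k : Module.End ℚ (MvPolynomial (Fin 4) ℚ)) (monomial s r)
      = monomial (s - Finsupp.single i k) (r * ((s i).descFactorial k : ℚ)) := by
  intro k
  induction k with
  | zero => simp
  | succ k ih =>
    rw [pow_succ', Module.End.mul_apply, ih]
    change pderiv i _ = _
    rw [pderiv_monomial, tsub_tsub, ← Finsupp.single_add, Nat.descFactorial_succ]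
    congr 1
    simp only [Finsupp.coe_tsub, Pi.sub_apply, Finsupp.single_eq_same]
    push_cast
    ring

/-- The multi-index of a derivative in the first three variables. -/
def mi (n : ℕ × ℕ × ℕ) : Fin 4 → ℕ := ![n.1, n.2.1, n.2.2, 0]

theorem diffOp_monomial (n : ℕ × ℕ × ℕ) (v : Pt) (r : ℚ) :
    diffOp (mi n) (monomial (tof v) r)
      = monomial (tof (v.1 - n.1, v.2.1 - n.2.1, v.2.2.1 - n.2.2, v.2.2.2))
          (r * (fal v n : ℚ)) := by
  simp only [diffOp, Module.End.mul_apply]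
  rw [pderiv_pow_monomial, pderiv_pow_monomial, pderiv_pow_monomial, pderiv_pow_monomial]
  have h1 : tof v - Finsupp.single 3 (mi n 3) - Finsupp.single 2 (mi n 2)
      - Finsupp.single 1 (mi n 1) - Finsupp.single 0 (mi n 0)
      = tof (v.1 - n.1, v.2.1 - n.2.1, v.2.2.1 - n.2.2, v.2.2.2) := by
    ext i
    simp only [Finsupp.tsub_apply, Finsupp.single_apply]
    fin_cases i <;> simp [tof, mi]
  rw [h1]
  congr 1
  simp only [Finsupp.tsub_apply, Finsupp.single_apply]
  simp [tof, mi, fal]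
  ring

theorem aeval_mono (p : Fin 4 → ℚ) (v : Pt) (r : ℚ) :
    aeval p (monomial (tof v) r) = r * ev p v := by
  rw [aeval_monomial, Finsupp.prod_fintype _ _ (by simp), Fin.prod_univ_four]
  rfl

theorem fal_mul_ev (p : Fin 4 → ℚ) (v : Pt) (n : ℕ × ℕ × ℕ) :
    (fal v n : ℚ) * ev p (v.1 - n.1, v.2.1 - n.2.1, v.2.2.1 - n.2.2, v.2.2.2)
      * (p 0 ^ n.1 * p 1 ^ n.2.1 * p 2 ^ n.2.2) = (fal v n : ℚ) * ev p v := by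
  have key : ∀ (x : ℚ) (i k : ℕ), (i.descFactorial k : ℚ) * x ^ (i - k) * x ^ k
      = (i.descFactorial k : ℚ) * x ^ i := by
    intro x i k
    by_cases h : k ≤ i
    · rw [mul_assoc, ← pow_add, Nat.sub_add_cancel h]
    · rw [Nat.descFactorial_eq_zero_iff_lt.2 (by omega)]
      simp
  obtain ⟨i, j, k, l⟩ := v
  obtain ⟨x, y, z⟩ := n
  simp only [fal, ev, Nat.cast_mul]
  have e1 := key (p 0) i x
  have e2 := key (p 1) j y
  have e3 := key (p 2) k z
  calc _ = ((i.descFactorial x : ℚ) * p 0 ^ (i - x) * p 0 ^ x)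
        * ((j.descFactorial y : ℚ) * p 1 ^ (j - y) * p 1 ^ y)
        * ((k.descFactorial z : ℚ) * p 2 ^ (k - z) * p 2 ^ z) * p 3 ^ l := by ring
    _ = _ := by rw [e1, e2, e3]; ring

theorem nus_lt (m : ℕ) (n : ℕ × ℕ × ℕ) (hn : n ∈ nus m) : ∑ j, mi n j < m := by
  have h3 : ∀ n ∈ nus 3, n.1 + n.2.1 + n.2.2 < 3 := by decide
  have h4 : ∀ n ∈ nus 4, n.1 + n.2.1 + n.2.2 < 4 := by decide
  rw [Fin.sum_univ_four]
  change n.1 + n.2.1 + n.2.2 + 0 < m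
  by_cases e3 : m = 3
  · subst e3; exact h3 n hn
  · by_cases e4 : m = 4
    · subst e4; exact h4 n hn
    · unfold nus at hn
      split at hn
      · exact absurd rfl e3
      · exact absurd rfl e4
      · simp at hn

theorem homog_eq_sum (D : Finset Pt)
    (hD : ∀ v : Pt, v ∈ D ↔ v.1 + (v.2.1 + (v.2.2.1 + v.2.2.2)) = 19)
    (f : MvPolynomial (Fin 4) ℚ) (hf : f.IsHomogeneous 19) :
    f = ∑ v ∈ D, monomial (tof v) (coeff (tof v) f) := by
  conv_lhs => rw [f.as_sum]
  have hinj : ∀ v ∈ D, ∀ u ∈ D, tof v = tof u → v = u := fun v _ u _ h => by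
    rw [← oft_tof v, ← oft_tof u, h]
  classical
  rw [← Finset.sum_image (f := fun s => monomial s (coeff s f)) hinj]
  refine Finset.sum_subset ?_ ?_
  · intro s hs
    rw [Finset.mem_image]
    refine ⟨oft s, (hD _).2 ?_, tof_oft s⟩
    have h1 := hf (mem_support_iff.1 hs)
    rw [Finsupp.weight_apply, Finsupp.sum_fintype _ _ (by simp), Fin.sum_univ_four] at h1
    simp at h1
    simp only [oft]
    omega
  · intro s _ hs
    rw [notMem_support_iff.1 hs, monomial_zero]

theorem cond_of_vanishing (D : Finset Pt)
    (hD : ∀ v : Pt, v ∈ D ↔ v.1 + (v.2.1 + (v.2.2.1 + v.2.2.2)) = 19)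
    (f : MvPolynomial (Fin 4) ℚ) (hf : f.IsHomogeneous 19) (m : ℕ) (p : Fin 4 → ℚ)
    (h : f ∈ vanishingSpace m p) : Cond m p D (fun v => coeff (tof v) f) := by
  intro n hn
  simp only [vanishingSpace, Submodule.mem_iInf] at h
  have h1 := h (mi n) (nus_lt m n hn)
  rw [LinearMap.mem_ker, LinearMap.comp_apply] at h1
  rw [homog_eq_sum D hD f hf, map_sum, map_sum] at h1
  simp only [diffOp_monomial, AlgHom.toLinearMap_apply, aeval_mono] at h1
  have h2 := congrArg (fun x => x * (p 0 ^ n.1 * p 1 ^ n.2.1 * p 2 ^ n.2.2)) h1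
  simp only [zero_mul, Finset.sum_mul] at h2
  rw [← h2]
  refine Finset.sum_congr rfl fun v _ => ?_
  rw [mul_assoc, ← fal_mul_ev]
  ring

theorem nonSpecial_of_solv (D : Finset Pt)
    (hD : ∀ v : Pt, v ∈ D ↔ v.1 + (v.2.1 + (v.2.2.1 + v.2.2.2)) = 19)
    (a b : ℕ) (hab : 2 * a + b = 154) (h : Solv D a b) :
    nonSpecial 19 (List.replicate a 4 ++ List.replicate b 3) ∧
      vdim 19 (List.replicate a 4 ++ List.replicate b 3) = -1 := by
  have hv : vdim 19 (List.replicate a 4 ++ List.replicate b 3) = -1 := by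
    simp only [vdim, List.map_append, List.map_replicate, List.sum_append, List.sum_replicate]
    have e1 : (19 + 3).choose 3 = 1540 := by decide
    have e2 : (4 + 2).choose 3 = 20 := by decide
    have e3 : (3 + 2).choose 3 = 10 := by decide
    rw [e1, e2, e3]
    simp only [nsmul_eq_mul]
    push_cast
    omega
  refine ⟨?_, hv⟩
  obtain ⟨P4, P3, l4, l3, hpos, hpw, hk⟩ := h
  set ms := List.replicate a 4 ++ List.replicate b 3 with hms
  have hlen : ms.length = (P4 ++ P3).length := by simp [hms, l4, l3]
  refine ⟨fun i => (P4 ++ P3).get (Fin.cast hlen i), ?_, ?_, ?_⟩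
  · intro i h0
    have h1 := hpos _ (List.get_mem (P4 ++ P3) (Fin.cast hlen i)) 0
    have h2 := congrFun h0 0
    exact h1.ne h2.symm
  · intro i j hij
    rw [List.pairwise_iff_get] at hpw
    rcases lt_or_gt_of_ne hij with hlt | hlt
    · exact hpw (Fin.cast hlen i) (Fin.cast hlen j) hlt
    · exact Ind_symm (hpw (Fin.cast hlen j) (Fin.cast hlen i) hlt)
  · rw [hv]
    have hbot : systemSpace 19 ms (fun i => (P4 ++ P3).get (Fin.cast hlen i)) = ⊥ := by
      rw [eq_bot_iff]
      intro f hf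
      rw [systemSpace, Submodule.mem_inf, mem_homogeneousSubmodule, Submodule.mem_iInf] at hf
      obtain ⟨hf, hvan⟩ := hf
      have hcond : ∀ x ∈ P4.map (fun p => (4, p)) ++ P3.map (fun p => (3, p)),
          Cond x.1 x.2 D (fun v => coeff (tof v) f) := by
        intro x hx
        refine cond_of_vanishing D hD f hf x.1 x.2 ?_
        rcases List.mem_append.1 hx with hx | hx
        · obtain ⟨p, hp, rfl⟩ := List.mem_map.1 hx
          obtain ⟨i, hi, rfl⟩ := List.getElem_of_mem hp
          have h1 := hvan ⟨i, by rw [hlen, List.length_append]; omega⟩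
          simpa [hms, List.getElem_append, hi, ← l4] using h1
        · obtain ⟨p, hp, rfl⟩ := List.mem_map.1 hx
          obtain ⟨i, hi, rfl⟩ := List.getElem_of_mem hp
          have h1 := hvan ⟨P4.length + i, by rw [hlen, List.length_append]; omega⟩
          simpa [hms, List.getElem_append, ← l4] using h1
      have h0 := hk _ hcond
      rw [Submodule.mem_bot, homog_eq_sum D hD f hf]
      refine Finset.sum_eq_zero fun v hv => ?_
      rw [h0 v hv, monomial_zero]
    rw [hbot]
    simp
/-! ### The data -/

/-- Block 0. -/
def blk0 : Blk where
  q := [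
    ⟨(0, 86, 76, 81), 258, [
      (19, 0, 0, 0), (18, 0, 0, 1), (18, 1, 0, 0), (18, 0, 1, 0), (17, 0, 0, 2),
      (17, 1, 0, 1), (17, 0, 1, 1), (17, 2, 0, 0), (17, 1, 1, 0), (17, 0, 2, 0),
      (16, 0, 0, 3), (16, 1, 0, 2), (16, 0, 1, 2), (16, 2, 0, 1), (16, 1, 1, 1),
      (16, 0, 2, 1), (16, 3, 0, 0), (16, 2, 1, 0), (16, 1, 2, 0), (16, 0, 3, 0)]⟩,
    ⟨(0, 38, 76, 72), 266, [
      (15, 1, 0, 3), (14, 5, 0, 0), (15, 2, 0, 2), (15, 1, 1, 2), (13, 6, 0, 0),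
      (14, 4, 0, 1), (14, 4, 1, 0), (15, 4, 0, 0), (15, 2, 1, 1), (15, 2, 2, 0),
      (12, 7, 0, 0), (13, 5, 0, 1), (13, 5, 1, 0), (14, 3, 0, 2), (14, 3, 1, 1),
      (14, 3, 2, 0), (15, 3, 0, 1), (15, 3, 1, 0), (15, 1, 2, 1), (15, 1, 3, 0)]⟩,
    ⟨(0, 73, 46, 97), 359, [
      (15, 0, 1, 3), (14, 0, 5, 0), (14, 1, 4, 0), (15, 0, 2, 2), (13, 0, 6, 0),
      (13, 1, 4, 1), (14, 0, 4, 1), (13, 2, 4, 0), (14, 1, 3, 1), (15, 0, 4, 0),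
      (12, 0, 7, 0), (12, 1, 6, 0), (13, 0, 5, 1), (14, 2, 3, 0), (13, 1, 5, 0),
      (14, 0, 3, 2), (13, 3, 3, 0), (14, 2, 2, 1), (14, 1, 2, 2), (15, 0, 3, 1)]⟩,
    ⟨(0, 72, 85, 104), 536, [
      (15, 0, 0, 4), (14, 0, 0, 5), (14, 1, 0, 4), (14, 0, 1, 4), (13, 4, 0, 2),
      (13, 3, 0, 3), (13, 4, 1, 1), (14, 2, 0, 3), (14, 1, 1, 3), (14, 0, 2, 3),
      (12, 6, 0, 1), (12, 5, 2, 0), (12, 6, 1, 0), (13, 2, 2, 2), (13, 3, 1, 2),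
      (13, 4, 2, 0), (13, 1, 3, 2), (14, 2, 1, 2), (13, 3, 2, 1), (13, 2, 3, 1)]⟩]
  t := [
    ⟨(0, 70, 63, 48), 140, [
      (19, 0, 0, 0), (18, 0, 0, 1), (18, 1, 0, 0), (18, 0, 1, 0), (17, 0, 0, 2),
      (17, 1, 0, 1), (17, 0, 1, 1), (17, 2, 0, 0), (17, 1, 1, 0), (17, 0, 2, 0)]⟩,
    ⟨(0, 19, 42, 41), 103, [
      (16, 1, 0, 2), (15, 4, 0, 0), (16, 3, 0, 0), (16, 1, 1, 1), (14, 5, 0, 0),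
      (15, 3, 0, 1), (15, 3, 1, 0), (16, 2, 0, 1), (16, 2, 1, 0), (16, 1, 2, 0)]⟩,
    ⟨(0, 23, 50, 32), 137, [
      (16, 0, 0, 3), (15, 0, 0, 4), (15, 1, 0, 3), (16, 0, 1, 2), (14, 4, 0, 1),
      (14, 3, 0, 2), (15, 1, 1, 2), (15, 2, 0, 2), (15, 2, 1, 1), (16, 0, 2, 1)]⟩,
    ⟨(0, 98, 58, 92), 330, [
      (16, 0, 3, 0), (15, 0, 3, 1), (15, 1, 3, 0), (15, 0, 4, 0), (14, 0, 4, 1),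
      (14, 1, 4, 0), (14, 0, 5, 0), (15, 2, 2, 0), (15, 1, 2, 1), (15, 0, 2, 2)]⟩,
    ⟨(0, 46, 105, 91), 367, [
      (13, 6, 0, 0), (12, 6, 0, 1), (13, 5, 0, 1), (13, 5, 1, 0), (14, 2, 0, 3),
      (12, 7, 0, 0), (14, 4, 1, 0), (13, 4, 0, 2), (14, 3, 1, 1), (14, 3, 2, 0)]⟩,
    ⟨(0, 42, 25, 60), 195, [
      (13, 0, 6, 0), (12, 0, 7, 0), (13, 1, 5, 0), (13, 0, 5, 1), (14, 0, 3, 2),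
      (14, 1, 3, 1), (12, 1, 6, 0), (14, 2, 3, 0), (13, 2, 4, 0), (14, 2, 2, 1)]⟩,
    ⟨(0, 82, 92, 113), 543, [
      (15, 0, 1, 3), (14, 0, 2, 3), (14, 1, 2, 2), (14, 1, 1, 3), (13, 4, 1, 1),
      (13, 3, 2, 1), (13, 4, 2, 0), (14, 2, 1, 2), (13, 3, 3, 0), (14, 1, 0, 4)]⟩,
    ⟨(0, 68, 80, 96), 500, [
      (14, 0, 0, 5), (13, 3, 0, 3), (13, 2, 3, 1), (14, 0, 1, 4), (12, 6, 1, 0),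
      (12, 5, 2, 0), (13, 3, 1, 2), (13, 1, 4, 1), (13, 2, 2, 2), (13, 1, 3, 2)]⟩]

/-- Block 1. -/
def blk1 : Blk where
  q := [
    ⟨(81, 0, 76, 86), 258, [
      (0, 19, 0, 0), (1, 18, 0, 0), (0, 18, 0, 1), (0, 18, 1, 0), (2, 17, 0, 0),
      (1, 17, 0, 1), (1, 17, 1, 0), (0, 17, 0, 2), (0, 17, 1, 1), (0, 17, 2, 0),
      (3, 16, 0, 0), (2, 16, 0, 1), (2, 16, 1, 0), (1, 16, 0, 2), (1, 16, 1, 1),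
      (1, 16, 2, 0), (0, 16, 0, 3), (0, 16, 1, 2), (0, 16, 2, 1), (0, 16, 3, 0)]⟩,
    ⟨(72, 0, 76, 38), 266, [
      (0, 15, 0, 4), (1, 15, 0, 3), (0, 14, 0, 5), (0, 15, 1, 3), (2, 15, 0, 2),
      (1, 14, 0, 4), (1, 15, 1, 2), (0, 13, 0, 6), (0, 14, 1, 4), (0, 15, 2, 2),
      (3, 15, 0, 1), (2, 14, 0, 3), (2, 15, 1, 1), (1, 13, 0, 5), (1, 14, 1, 3),
      (1, 15, 2, 1), (0, 12, 0, 7), (0, 13, 1, 5), (0, 14, 2, 3), (0, 15, 3, 1)]⟩,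
    ⟨(97, 0, 46, 73), 359, [
      (0, 15, 4, 0), (1, 15, 3, 0), (0, 14, 4, 1), (0, 14, 5, 0), (2, 15, 2, 0),
      (1, 14, 3, 1), (1, 14, 4, 0), (0, 13, 4, 2), (0, 13, 5, 1), (0, 13, 6, 0),
      (3, 15, 1, 0), (2, 14, 2, 1), (2, 14, 3, 0), (1, 13, 4, 1), (1, 13, 5, 0),
      (1, 14, 2, 2), (0, 12, 6, 1), (0, 12, 7, 0), (0, 14, 3, 2), (0, 13, 3, 3)]⟩,
    ⟨(104, 0, 85, 72), 536, [
      (0, 12, 1, 6), (1, 12, 0, 6), (0, 13, 2, 4), (0, 12, 2, 5), (2, 13, 0, 4),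
      (1, 13, 2, 3), (1, 13, 1, 4), (4, 14, 0, 1), (2, 13, 3, 1), (1, 13, 3, 2),
      (3, 13, 0, 3), (4, 15, 0, 0), (3, 14, 0, 2), (5, 14, 0, 0), (2, 14, 1, 2),
      (2, 13, 1, 3), (3, 14, 1, 1), (4, 14, 1, 0), (3, 14, 2, 0), (2, 13, 2, 2)]⟩]
  t := [
    ⟨(48, 0, 63, 70), 140, [
      (0, 19, 0, 0), (1, 18, 0, 0), (0, 18, 0, 1), (0, 18, 1, 0), (2, 17, 0, 0),
      (1, 17, 0, 1), (1, 17, 1, 0), (0, 17, 0, 2), (0, 17, 1, 1), (0, 17, 2, 0)]⟩,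
    ⟨(41, 0, 42, 19), 103, [
      (0, 16, 0, 3), (1, 16, 0, 2), (0, 15, 0, 4), (0, 16, 1, 2), (2, 16, 0, 1),
      (1, 15, 0, 3), (1, 16, 1, 1), (0, 14, 0, 5), (0, 15, 1, 3), (0, 16, 2, 1)]⟩,
    ⟨(32, 0, 50, 23), 137, [
      (1, 14, 0, 4), (2, 14, 0, 3), (2, 15, 0, 2), (2, 15, 1, 1), (3, 15, 0, 1),
      (4, 15, 0, 0), (1, 15, 1, 2), (3, 16, 0, 0), (2, 16, 1, 0), (1, 16, 2, 0)]⟩,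
    ⟨(92, 0, 58, 98), 330, [
      (0, 16, 3, 0), (1, 15, 3, 0), (0, 15, 3, 1), (0, 15, 4, 0), (2, 15, 2, 0),
      (1, 14, 4, 0), (1, 15, 2, 1), (0, 14, 4, 1), (0, 14, 5, 0), (0, 15, 2, 2)]⟩,
    ⟨(91, 0, 105, 46), 367, [
      (0, 13, 0, 6), (1, 13, 0, 5), (0, 12, 0, 7), (0, 13, 1, 5), (2, 13, 0, 4),
      (1, 12, 0, 6), (1, 14, 1, 3), (3, 14, 0, 2), (0, 14, 1, 4), (0, 14, 2, 3)]⟩,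
    ⟨(60, 0, 25, 42), 195, [
      (0, 13, 6, 0), (1, 13, 5, 0), (0, 12, 6, 1), (0, 13, 5, 1), (2, 14, 3, 0),
      (1, 14, 3, 1), (1, 14, 2, 2), (0, 14, 3, 2), (0, 12, 7, 0), (0, 13, 4, 2)]⟩,
    ⟨(113, 0, 92, 82), 543, [
      (0, 13, 2, 4), (1, 13, 2, 3), (2, 14, 2, 1), (0, 13, 3, 3), (3, 14, 2, 0),
      (4, 14, 0, 1), (1, 13, 1, 4), (3, 15, 1, 0), (2, 14, 1, 2), (3, 14, 1, 1)]⟩,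
    ⟨(96, 0, 80, 68), 500, [
      (0, 12, 1, 6), (4, 14, 1, 0), (5, 14, 0, 0), (0, 12, 2, 5), (2, 13, 1, 3),
      (1, 13, 3, 2), (2, 13, 2, 2), (3, 13, 0, 3), (1, 13, 4, 1), (2, 13, 3, 1)]⟩]

/-- Block 2. -/
def blk2 : Blk where
  q := [
    ⟨(81, 86, 0, 76), 258, [
      (0, 0, 19, 0), (1, 0, 18, 0), (0, 1, 18, 0), (0, 0, 18, 1), (2, 0, 17, 0),
      (1, 1, 17, 0), (1, 0, 17, 1), (0, 2, 17, 0), (0, 1, 17, 1), (0, 0, 17, 2),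
      (3, 0, 16, 0), (2, 1, 16, 0), (2, 0, 16, 1), (1, 2, 16, 0), (1, 1, 16, 1),
      (1, 0, 16, 2), (0, 3, 16, 0), (0, 2, 16, 1), (0, 1, 16, 2), (0, 0, 16, 3)]⟩,
    ⟨(72, 38, 0, 76), 266, [
      (0, 1, 15, 3), (1, 1, 15, 2), (0, 2, 15, 2), (0, 5, 14, 0), (2, 1, 15, 1),
      (1, 2, 15, 1), (1, 4, 14, 0), (0, 4, 15, 0), (0, 4, 14, 1), (0, 5, 13, 1),
      (3, 1, 15, 0), (2, 2, 15, 0), (2, 3, 14, 0), (1, 3, 15, 0), (1, 5, 13, 0),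
      (1, 3, 14, 1), (0, 3, 15, 1), (0, 3, 14, 2), (0, 6, 13, 0), (0, 7, 12, 0)]⟩,
    ⟨(97, 73, 0, 46), 359, [
      (0, 0, 15, 4), (1, 0, 15, 3), (0, 1, 14, 4), (0, 0, 14, 5), (2, 0, 15, 2),
      (1, 1, 14, 3), (1, 0, 14, 4), (0, 2, 14, 3), (0, 1, 13, 5), (0, 0, 13, 6),
      (3, 0, 15, 1), (2, 1, 14, 2), (2, 0, 14, 3), (1, 2, 14, 2), (1, 1, 13, 4),
      (1, 0, 13, 5), (0, 3, 13, 3), (0, 2, 13, 4), (0, 1, 12, 6), (0, 0, 12, 7)]⟩,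
    ⟨(104, 72, 0, 85), 536, [
      (4, 0, 15, 0), (3, 0, 14, 2), (3, 1, 14, 1), (4, 0, 14, 1), (5, 0, 14, 0),
      (4, 1, 14, 0), (2, 1, 13, 3), (3, 2, 14, 0), (2, 2, 13, 2), (1, 2, 13, 3),
      (2, 2, 14, 1), (1, 4, 13, 1), (0, 4, 13, 2), (1, 3, 13, 2), (3, 3, 13, 0),
      (0, 6, 12, 1), (2, 4, 13, 0), (2, 3, 13, 1), (0, 5, 12, 2), (1, 6, 12, 0)]⟩]
  t := [
    ⟨(48, 70, 0, 63), 140, [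
      (0, 0, 19, 0), (1, 0, 18, 0), (0, 1, 18, 0), (0, 0, 18, 1), (2, 0, 17, 0),
      (1, 1, 17, 0), (1, 0, 17, 1), (0, 2, 17, 0), (0, 1, 17, 1), (0, 0, 17, 2)]⟩,
    ⟨(41, 19, 0, 42), 103, [
      (0, 1, 16, 2), (1, 1, 16, 1), (0, 3, 16, 0), (0, 3, 15, 1), (2, 1, 16, 0),
      (1, 2, 16, 0), (1, 3, 15, 0), (0, 2, 16, 1), (0, 4, 15, 0), (0, 5, 14, 0)]⟩,
    ⟨(32, 23, 0, 50), 137, [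
      (1, 0, 16, 2), (3, 0, 16, 0), (3, 1, 15, 0), (4, 0, 15, 0), (2, 0, 16, 1),
      (2, 2, 15, 0), (1, 2, 15, 1), (2, 1, 15, 1), (1, 4, 14, 0), (2, 3, 14, 0)]⟩,
    ⟨(92, 98, 0, 58), 330, [
      (0, 0, 16, 3), (1, 0, 15, 3), (1, 1, 15, 2), (0, 0, 15, 4), (2, 0, 15, 2),
      (0, 1, 15, 3), (1, 0, 14, 4), (0, 2, 15, 2), (0, 1, 14, 4), (0, 0, 14, 5)]⟩,
    ⟨(91, 46, 0, 105), 367, [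
      (0, 6, 13, 0), (1, 5, 13, 0), (0, 5, 13, 1), (0, 4, 14, 1), (2, 4, 13, 0),
      (1, 3, 14, 1), (3, 2, 14, 0), (0, 3, 14, 2), (0, 7, 12, 0), (1, 6, 12, 0)]⟩,
    ⟨(60, 42, 0, 25), 195, [
      (0, 0, 13, 6), (1, 0, 13, 5), (0, 1, 13, 5), (0, 0, 12, 7), (2, 0, 14, 3),
      (1, 1, 14, 3), (1, 2, 14, 2), (0, 2, 13, 4), (0, 1, 12, 6), (0, 2, 14, 3)]⟩,
    ⟨(113, 82, 0, 92), 543, [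
      (3, 0, 15, 1), (2, 1, 14, 2), (2, 2, 14, 1), (3, 0, 14, 2), (4, 1, 14, 0),
      (3, 1, 14, 1), (1, 4, 13, 1), (1, 3, 13, 2), (0, 4, 13, 2), (0, 3, 13, 3)]⟩,
    ⟨(96, 68, 0, 80), 500, [
      (4, 0, 14, 1), (5, 0, 14, 0), (0, 6, 12, 1), (0, 5, 12, 2), (1, 2, 13, 3),
      (1, 1, 13, 4), (2, 3, 13, 1), (2, 2, 13, 2), (2, 1, 13, 3), (3, 3, 13, 0)]⟩]

/-- Block 3. -/
def blk3 : Blk where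
  q := [
    ⟨(81, 86, 76, 0), 258, [
      (0, 0, 0, 19), (1, 0, 0, 18), (0, 1, 0, 18), (0, 0, 1, 18), (2, 0, 0, 17),
      (1, 1, 0, 17), (1, 0, 1, 17), (0, 2, 0, 17), (0, 1, 1, 17), (0, 0, 2, 17),
      (3, 0, 0, 16), (2, 1, 0, 16), (2, 0, 1, 16), (1, 2, 0, 16), (1, 1, 1, 16),
      (1, 0, 2, 16), (0, 3, 0, 16), (0, 2, 1, 16), (0, 1, 2, 16), (0, 0, 3, 16)]⟩,
    ⟨(72, 38, 76, 0), 266, [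
      (0, 4, 0, 15), (1, 4, 0, 14), (0, 5, 0, 14), (0, 4, 1, 14), (2, 2, 0, 15),
      (1, 5, 0, 13), (1, 2, 1, 15), (0, 6, 0, 13), (0, 5, 1, 13), (0, 2, 2, 15),
      (3, 1, 0, 15), (2, 3, 0, 14), (2, 1, 1, 15), (1, 3, 0, 15), (1, 3, 1, 14),
      (1, 1, 2, 15), (0, 7, 0, 12), (0, 3, 1, 15), (0, 3, 2, 14), (0, 1, 3, 15)]⟩,
    ⟨(97, 73, 46, 0), 359, [
      (0, 0, 4, 15), (1, 0, 4, 14), (0, 1, 4, 14), (0, 0, 5, 14), (2, 0, 2, 15),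
      (1, 1, 4, 13), (1, 0, 5, 13), (0, 2, 4, 13), (0, 1, 5, 13), (0, 0, 6, 13),
      (3, 0, 1, 15), (2, 1, 2, 14), (2, 0, 3, 14), (1, 2, 2, 14), (1, 1, 3, 14),
      (1, 0, 3, 15), (0, 3, 3, 13), (0, 2, 3, 14), (0, 1, 6, 12), (0, 0, 7, 12)]⟩,
    ⟨(104, 72, 85, 0), 536, [
      (4, 0, 0, 15), (5, 0, 0, 14), (4, 1, 0, 14), (4, 0, 1, 14), (3, 2, 0, 14),
      (3, 3, 0, 13), (3, 1, 1, 14), (2, 4, 0, 13), (1, 4, 1, 13), (0, 5, 2, 12),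
      (1, 6, 0, 12), (0, 6, 1, 12), (2, 2, 1, 14), (2, 3, 1, 13), (3, 0, 2, 14),
      (1, 3, 2, 13), (0, 4, 2, 13), (2, 2, 2, 13), (1, 2, 3, 13), (2, 1, 3, 13)]⟩]
  t := [
    ⟨(48, 70, 63, 0), 140, [
      (0, 0, 0, 19), (1, 0, 0, 18), (0, 1, 0, 18), (0, 0, 1, 18), (2, 0, 0, 17),
      (1, 1, 0, 17), (1, 0, 1, 17), (0, 2, 0, 17), (0, 1, 1, 17), (0, 0, 2, 17)]⟩,
    ⟨(41, 19, 42, 0), 103, [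
      (0, 3, 0, 16), (1, 3, 0, 15), (0, 4, 0, 15), (0, 3, 1, 15), (2, 1, 0, 16),
      (1, 2, 0, 16), (1, 1, 1, 16), (0, 5, 0, 14), (0, 2, 1, 16), (0, 1, 2, 16)]⟩,
    ⟨(32, 23, 50, 0), 137, [
      (3, 0, 0, 16), (4, 0, 0, 15), (3, 1, 0, 15), (2, 0, 1, 16), (2, 2, 0, 15),
      (1, 4, 0, 14), (1, 2, 1, 15), (2, 3, 0, 14), (2, 1, 1, 15), (1, 0, 2, 16)]⟩,
    ⟨(92, 98, 58, 0), 330, [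
      (0, 0, 3, 16), (1, 0, 3, 15), (0, 1, 3, 15), (0, 0, 4, 15), (2, 0, 2, 15),
      (1, 1, 2, 15), (1, 0, 4, 14), (0, 2, 2, 15), (0, 1, 4, 14), (0, 0, 5, 14)]⟩,
    ⟨(91, 46, 105, 0), 367, [
      (0, 6, 0, 13), (1, 6, 0, 12), (0, 7, 0, 12), (0, 4, 1, 14), (3, 2, 0, 14),
      (1, 5, 0, 13), (1, 3, 1, 14), (2, 4, 0, 13), (0, 5, 1, 13), (0, 3, 2, 14)]⟩,
    ⟨(60, 42, 25, 0), 195, [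
      (0, 0, 6, 13), (1, 0, 5, 13), (0, 1, 6, 12), (0, 0, 7, 12), (2, 0, 3, 14),
      (1, 1, 3, 14), (1, 2, 2, 14), (0, 2, 3, 14), (0, 1, 5, 13), (0, 2, 4, 13)]⟩,
    ⟨(113, 82, 92, 0), 543, [
      (3, 0, 1, 15), (4, 1, 0, 14), (3, 1, 1, 14), (3, 0, 2, 14), (2, 1, 2, 14),
      (2, 2, 1, 14), (1, 4, 1, 13), (1, 3, 2, 13), (0, 4, 2, 13), (0, 3, 3, 13)]⟩,
    ⟨(96, 68, 80, 0), 500, [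
      (5, 0, 0, 14), (4, 0, 1, 14), (1, 1, 4, 13), (1, 2, 3, 13), (2, 3, 1, 13),
      (0, 6, 1, 12), (2, 2, 2, 13), (3, 3, 0, 13), (0, 5, 2, 12), (2, 1, 3, 13)]⟩]

/-- Block 4. -/
def blk4 : Blk where
  q := [
    ⟨(719, 0, 570, 360), 3598, [
      (0, 11, 0, 8), (1, 11, 0, 7), (0, 10, 0, 9), (0, 11, 1, 7), (2, 11, 0, 6),
      (2, 12, 0, 5), (1, 11, 1, 6), (3, 12, 0, 4), (0, 10, 1, 8), (0, 11, 2, 6),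
      (1, 12, 1, 5), (0, 12, 3, 4), (2, 12, 1, 4), (3, 13, 1, 2), (1, 12, 2, 4),
      (1, 12, 3, 3), (4, 13, 0, 2), (0, 12, 4, 3), (0, 12, 5, 2), (0, 11, 3, 5)]⟩]
  t := [
    ⟨(66, 0, 61, 37), 338, [
      (0, 11, 0, 8), (1, 11, 0, 7), (0, 10, 0, 9), (0, 11, 1, 7), (2, 12, 0, 5),
      (4, 13, 0, 2), (3, 13, 1, 2), (1, 12, 1, 5), (0, 12, 3, 4), (1, 12, 2, 4)]⟩,
    ⟨(720, 0, 577, 363), 3618, [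
      (0, 10, 1, 8), (1, 11, 1, 6), (0, 11, 2, 6), (0, 11, 3, 5), (2, 12, 1, 4),
      (1, 12, 3, 3), (3, 12, 0, 4), (0, 12, 4, 3), (0, 12, 5, 2), (2, 11, 0, 6)]⟩]

/-- Block 5. -/
def blk5 : Blk where
  q := [
    ⟨(36, 28, 15, 0), 160, [
      (0, 0, 8, 11), (1, 0, 8, 10), (0, 1, 8, 10), (0, 0, 9, 10), (2, 0, 4, 13),
      (2, 1, 4, 12), (1, 0, 6, 12), (0, 2, 5, 12), (0, 1, 7, 11), (0, 0, 10, 9),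
      (3, 0, 3, 13), (1, 1, 6, 11), (2, 0, 5, 12), (1, 2, 4, 12), (1, 1, 5, 12),
      (1, 0, 7, 11), (0, 3, 4, 12), (0, 2, 6, 11), (0, 4, 3, 12), (0, 3, 5, 11)]⟩]
  t := [
    ⟨(120, 84, 50, 0), 470, [
      (0, 0, 8, 11), (1, 0, 6, 12), (0, 1, 7, 11), (0, 0, 9, 10), (2, 0, 4, 13),
      (1, 1, 5, 12), (1, 0, 7, 11), (0, 2, 5, 12), (0, 3, 4, 12), (0, 2, 6, 11)]⟩,
    ⟨(35, 27, 15, 0), 157, [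
      (0, 0, 10, 9), (1, 0, 8, 10), (0, 1, 8, 10), (2, 0, 5, 12), (3, 0, 3, 13),
      (1, 1, 6, 11), (2, 1, 4, 12), (1, 2, 4, 12), (0, 4, 3, 12), (0, 3, 5, 11)]⟩]

/-- Block 6. -/
def blk6 : Blk where
  q := [
    ⟨(63, 65, 0, 26), 299, [
      (0, 0, 11, 8), (1, 0, 11, 7), (0, 1, 11, 7), (1, 0, 12, 6), (2, 0, 11, 6),
      (1, 1, 11, 6), (2, 0, 12, 5), (0, 2, 11, 6), (1, 1, 12, 5), (2, 0, 13, 4),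
      (3, 0, 12, 4), (2, 1, 12, 4), (3, 0, 13, 3), (1, 2, 12, 4), (0, 2, 12, 5),
      (1, 0, 10, 8), (0, 3, 12, 4), (0, 1, 10, 8), (0, 1, 9, 9), (1, 0, 9, 9)]⟩]
  t := [
    ⟨(89, 60, 0, 29), 296, [
      (0, 0, 11, 8), (1, 0, 11, 7), (0, 1, 11, 7), (1, 0, 12, 6), (2, 0, 13, 4),
      (1, 1, 12, 5), (0, 2, 12, 5), (0, 2, 11, 6), (0, 3, 12, 4), (0, 1, 10, 8)]⟩,
    ⟨(71, 69, 0, 29), 332, [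
      (1, 0, 10, 8), (2, 0, 12, 5), (2, 1, 12, 4), (2, 0, 11, 6), (3, 0, 13, 3),
      (1, 1, 11, 6), (3, 0, 12, 4), (1, 2, 12, 4), (0, 1, 9, 9), (1, 0, 9, 9)]⟩]

/-- Block 7. -/
def blk7 : Blk where
  q := [
    ⟨(416, 278, 0, 169), 2002, [
      (0, 2, 10, 7), (1, 2, 10, 6), (0, 3, 10, 6), (0, 3, 11, 5), (2, 2, 12, 3),
      (1, 3, 11, 4), (1, 3, 12, 3), (0, 4, 10, 5), (0, 4, 11, 4), (0, 4, 12, 3),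
      (3, 2, 13, 1), (3, 1, 13, 2), (4, 0, 13, 2), (1, 4, 12, 2), (1, 2, 11, 5),
      (1, 5, 12, 1), (0, 5, 11, 3), (1, 1, 10, 7), (0, 2, 9, 8), (2, 1, 11, 5)]⟩]
  t := [
    ⟨(748, 459, 0, 309), 3321, [
      (0, 4, 12, 3), (1, 4, 12, 2), (1, 3, 12, 3), (0, 4, 11, 4), (3, 1, 13, 2),
      (0, 3, 11, 5), (1, 2, 11, 5), (0, 5, 11, 3), (0, 2, 10, 7), (0, 3, 10, 6)]⟩,
    ⟨(429, 289, 0, 177), 2070, [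
      (0, 2, 9, 8), (1, 2, 10, 6), (1, 1, 10, 7), (2, 2, 12, 3), (3, 2, 13, 1),
      (2, 1, 11, 5), (1, 5, 12, 1), (4, 0, 13, 2), (1, 3, 11, 4), (0, 4, 10, 5)]⟩]

/-- Block 8. -/
def blk8 : Blk where
  q := [
    ⟨(464, 306, 0, 208), 2468, [
      (2, 0, 10, 7), (3, 0, 11, 5), (3, 1, 12, 3), (3, 2, 12, 2), (4, 1, 13, 1),
      (4, 2, 13, 0), (2, 2, 11, 4), (2, 4, 12, 1), (2, 3, 12, 2), (2, 5, 12, 0),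
      (1, 4, 11, 3), (1, 5, 11, 2), (0, 5, 10, 4), (0, 6, 10, 3), (0, 6, 11, 2),
      (0, 7, 11, 1), (0, 8, 11, 0), (0, 3, 9, 7), (1, 3, 10, 5), (1, 1, 9, 8)]⟩]
  t := [
    ⟨(69, 47, 0, 35), 372, [
      (0, 6, 11, 2), (1, 4, 11, 3), (0, 7, 11, 1), (2, 3, 12, 2), (2, 2, 11, 4),
      (2, 4, 12, 1), (3, 1, 12, 3), (3, 2, 12, 2), (4, 1, 13, 1), (4, 2, 13, 0)]⟩,
    ⟨(466, 308, 0, 209), 2475, [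
      (0, 5, 10, 4), (2, 0, 10, 7), (0, 6, 10, 3), (0, 3, 9, 7), (1, 3, 10, 5),
      (1, 5, 11, 2), (3, 0, 11, 5), (1, 1, 9, 8), (0, 8, 11, 0), (2, 5, 12, 0)]⟩]

/-- Block 9. -/
def blk9 : Blk where
  q := [
    ⟨(272, 240, 0, 181), 1871, [
      (5, 0, 13, 1), (6, 0, 13, 0), (5, 1, 13, 0), (5, 0, 12, 2), (4, 0, 12, 3),
      (4, 1, 12, 2), (6, 0, 12, 1), (4, 2, 12, 1), (5, 1, 12, 1), (4, 0, 11, 4),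
      (3, 3, 12, 1), (3, 4, 12, 0), (2, 4, 11, 2), (5, 2, 12, 0), (4, 1, 11, 3),
      (3, 1, 11, 4), (4, 3, 12, 0), (2, 3, 11, 3), (3, 2, 11, 3), (2, 1, 10, 6)]⟩]
  t := [
    ⟨(25, 19, 0, 14), 152, [
      (5, 0, 13, 1), (6, 0, 13, 0), (5, 1, 13, 0), (4, 0, 12, 3), (3, 3, 12, 1),
      (4, 1, 12, 2), (2, 3, 11, 3), (4, 2, 12, 1), (3, 4, 12, 0), (3, 1, 11, 4)]⟩,
    ⟨(275, 238, 0, 180), 1878, [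
      (5, 0, 12, 2), (6, 0, 12, 1), (5, 1, 12, 1), (4, 0, 11, 4), (4, 3, 12, 0),
      (4, 1, 11, 3), (3, 2, 11, 3), (5, 2, 12, 0), (2, 4, 11, 2), (2, 1, 10, 6)]⟩]

/-- Block 10. -/
def blk10 : Blk where
  q := [
    ⟨(239, 209, 0, 149), 1730, [
      (2, 0, 9, 8), (3, 0, 10, 6), (3, 1, 10, 5), (5, 0, 11, 3), (7, 0, 12, 0),
      (5, 1, 11, 2), (4, 0, 10, 5), (1, 2, 9, 7), (2, 1, 9, 7), (6, 1, 12, 0),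
      (1, 4, 10, 4), (2, 2, 10, 5), (1, 6, 11, 1), (3, 3, 11, 2), (2, 5, 11, 1),
      (4, 2, 11, 2), (2, 3, 10, 4), (1, 7, 11, 0), (3, 4, 11, 1), (0, 4, 9, 6)]⟩]
  t := [
    ⟨(106, 100, 0, 72), 778, [
      (7, 0, 12, 0), (5, 0, 11, 3), (5, 1, 11, 2), (6, 1, 12, 0), (3, 0, 10, 6),
      (3, 1, 10, 5), (3, 3, 11, 2), (2, 2, 10, 5), (4, 2, 11, 2), (1, 6, 11, 1)]⟩,
    ⟨(246, 210, 0, 147), 1731, [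
      (2, 0, 9, 8), (4, 0, 10, 5), (2, 1, 9, 7), (2, 5, 11, 1), (1, 4, 10, 4),
      (1, 2, 9, 7), (1, 7, 11, 0), (2, 3, 10, 4), (0, 4, 9, 6), (3, 4, 11, 1)]⟩]

/-- Block 11. -/
def blk11 : Blk where
  q := [
    ⟨(39, 25, 9, 0), 153, [
      (0, 2, 7, 10), (1, 2, 7, 9), (0, 3, 7, 9), (0, 2, 8, 9), (2, 0, 7, 10),
      (1, 1, 7, 10), (1, 2, 5, 11), (0, 4, 4, 11), (0, 3, 8, 8), (0, 3, 6, 10),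
      (3, 0, 4, 12), (2, 1, 5, 11), (2, 0, 6, 11), (1, 3, 3, 12), (1, 3, 4, 11),
      (2, 0, 8, 9), (0, 5, 3, 11), (1, 1, 8, 9), (1, 2, 6, 10), (0, 4, 5, 10)]⟩]
  t := [
    ⟨(221, 149, 44, 0), 772, [
      (0, 2, 7, 10), (1, 1, 7, 10), (0, 3, 7, 9), (0, 2, 8, 9), (2, 0, 7, 10),
      (1, 2, 5, 11), (1, 1, 8, 9), (0, 4, 4, 11), (0, 3, 6, 10), (2, 0, 6, 11)]⟩,
    ⟨(215, 143, 53, 0), 874, [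
      (0, 4, 5, 10), (2, 1, 5, 11), (0, 3, 8, 8), (0, 5, 3, 11), (1, 2, 6, 10),
      (2, 0, 8, 9), (1, 3, 4, 11), (1, 3, 3, 12), (3, 0, 4, 12), (1, 2, 7, 9)]⟩]

/-- Block 12. -/
def blk12 : Blk where
  q := [
    ⟨(231, 140, 41, 0), 939, [
      (0, 6, 2, 11), (1, 4, 2, 12), (0, 4, 6, 9), (0, 4, 7, 8), (3, 1, 2, 13),
      (1, 2, 8, 8), (1, 4, 3, 11), (0, 5, 4, 10), (0, 5, 5, 9), (0, 4, 8, 7),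
      (2, 1, 6, 10), (2, 2, 4, 11), (2, 2, 3, 12), (1, 3, 5, 10), (2, 1, 7, 9),
      (2, 1, 8, 8), (3, 0, 5, 11), (1, 3, 6, 9), (1, 3, 7, 8), (3, 0, 6, 10)]⟩]
  t := [
    ⟨(28, 17, 7, 0), 117, [
      (0, 4, 6, 9), (1, 4, 2, 12), (0, 5, 4, 10), (0, 4, 7, 8), (3, 1, 2, 13),
      (2, 2, 3, 12), (1, 4, 3, 11), (2, 1, 6, 10), (1, 3, 5, 10), (0, 6, 2, 11)]⟩,
    ⟨(254, 161, 41, 0), 1024, [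
      (3, 0, 5, 11), (0, 5, 5, 9), (0, 4, 8, 7), (3, 0, 6, 10), (1, 3, 7, 8),
      (2, 2, 4, 11), (1, 3, 6, 9), (1, 2, 8, 8), (2, 1, 7, 9), (2, 1, 8, 8)]⟩]

/-- Block 13. -/
def blk13 : Blk where
  q := [
    ⟨(722, 601, 0, 241), 4572, [
      (3, 0, 9, 7), (4, 0, 9, 6), (3, 1, 9, 6), (3, 0, 8, 8), (2, 2, 9, 6),
      (1, 4, 9, 5), (2, 2, 8, 7), (0, 5, 9, 5), (3, 1, 8, 7), (3, 0, 7, 9),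
      (1, 3, 9, 6), (2, 3, 9, 5), (1, 3, 8, 7), (0, 6, 9, 4), (0, 5, 8, 6),
      (4, 1, 10, 4), (1, 5, 10, 3), (1, 4, 8, 6), (3, 2, 10, 4), (2, 4, 10, 3)]⟩]
  t := [
    ⟨(326, 244, 0, 102), 1852, [
      (3, 0, 9, 7), (0, 5, 9, 5), (3, 1, 9, 6), (3, 0, 8, 8), (1, 3, 9, 6),
      (2, 2, 9, 6), (1, 3, 8, 7), (1, 4, 9, 5), (0, 5, 8, 6), (1, 5, 10, 3)]⟩,
    ⟨(323, 252, 0, 101), 1957, [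
      (3, 0, 7, 9), (4, 0, 9, 6), (3, 1, 8, 7), (3, 2, 10, 4), (2, 2, 8, 7),
      (4, 1, 10, 4), (1, 4, 8, 6), (2, 3, 9, 5), (0, 6, 9, 4), (2, 4, 10, 3)]⟩]

/-- Block 14. -/
def blk14 : Blk where
  q := [
    ⟨(5431, 3691, 0, 2731), 36519, [
      (0, 7, 10, 2), (1, 7, 10, 1), (0, 8, 10, 1), (0, 7, 9, 3), (2, 5, 10, 2),
      (1, 8, 10, 0), (1, 5, 9, 4), (0, 9, 10, 0), (0, 8, 9, 2), (0, 6, 8, 5),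
      (3, 4, 10, 2), (3, 3, 10, 3), (2, 6, 11, 0), (1, 6, 10, 2), (1, 6, 9, 3),
      (3, 5, 11, 0), (2, 6, 10, 1), (0, 9, 9, 1), (4, 3, 11, 1), (4, 4, 11, 0)]⟩]
  t := [
    ⟨(31, 19, 0, 13), 179, [
      (0, 7, 10, 2), (1, 7, 10, 1), (0, 8, 10, 1), (0, 7, 9, 3), (2, 6, 11, 0),
      (1, 6, 10, 2), (1, 5, 9, 4), (0, 9, 10, 0), (0, 8, 9, 2), (0, 6, 8, 5)]⟩,
    ⟨(5465, 3710, 0, 2742), 36719, [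
      (0, 9, 9, 1), (1, 6, 9, 3), (1, 8, 10, 0), (3, 5, 11, 0), (2, 5, 10, 2),
      (4, 3, 11, 1), (3, 3, 10, 3), (2, 6, 10, 1), (4, 4, 11, 0), (3, 4, 10, 2)]⟩]

/-- Block 15. -/
def blk15 : Blk where
  q := [
    ⟨(0, 107, 169, 205), 1059, [
      (13, 2, 0, 4), (11, 8, 0, 0), (11, 7, 0, 1), (11, 7, 1, 0), (12, 5, 0, 2),
      (12, 4, 0, 3), (12, 5, 1, 1), (11, 6, 0, 2), (12, 4, 1, 2), (12, 4, 2, 1),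
      (10, 9, 0, 0), (10, 8, 1, 0), (13, 2, 1, 3), (12, 3, 4, 0), (11, 6, 1, 1),
      (11, 6, 2, 0), (11, 5, 3, 0), (12, 3, 3, 1), (12, 2, 5, 0), (12, 4, 3, 0)]⟩]
  t := [
    ⟨(0, 959, 1799, 1829), 9263, [
      (11, 8, 0, 0), (12, 5, 0, 2), (11, 7, 0, 1), (12, 5, 1, 1), (10, 9, 0, 0),
      (13, 2, 0, 4), (11, 7, 1, 0), (12, 4, 3, 0), (13, 2, 1, 3), (12, 4, 2, 1)]⟩,
    ⟨(0, 107, 169, 206), 1059, [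
      (12, 4, 0, 3), (11, 6, 0, 2), (12, 3, 4, 0), (12, 4, 1, 2), (10, 8, 1, 0),
      (11, 5, 3, 0), (11, 6, 1, 1), (12, 2, 5, 0), (12, 3, 3, 1), (11, 6, 2, 0)]⟩]

/-- Block 16. -/
def blk16 : Blk where
  q := [
    ⟨(409, 314, 0, 153), 2818, [
      (0, 5, 7, 7), (1, 4, 7, 7), (0, 6, 7, 6), (0, 5, 6, 8), (2, 2, 7, 8),
      (3, 1, 7, 8), (1, 5, 8, 5), (0, 7, 8, 4), (3, 2, 8, 6), (5, 0, 10, 4),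
      (3, 2, 9, 5), (2, 3, 8, 6), (4, 1, 9, 5), (2, 4, 9, 4), (6, 0, 11, 2),
      (5, 0, 9, 5), (5, 1, 10, 3), (4, 0, 8, 7), (4, 2, 10, 3), (3, 3, 9, 4)]⟩]
  t := [
    ⟨(59, 52, 0, 22), 406, [
      (5, 0, 10, 4), (4, 0, 8, 7), (4, 1, 9, 5), (5, 0, 9, 5), (3, 2, 9, 5),
      (6, 0, 11, 2), (2, 2, 7, 8), (3, 1, 7, 8), (2, 3, 8, 6), (4, 2, 10, 3)]⟩,
    ⟨(407, 314, 0, 152), 2806, [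
      (0, 5, 7, 7), (1, 4, 7, 7), (0, 6, 7, 6), (0, 5, 6, 8), (2, 4, 9, 4),
      (1, 5, 8, 5), (3, 2, 8, 6), (0, 7, 8, 4), (3, 3, 9, 4), (5, 1, 10, 3)]⟩]

/-- Block 17. -/
def blk17 : Blk where
  q := [
    ⟨(46, 26, 0, 37), 322, [
      (0, 10, 9, 0), (1, 9, 9, 0), (0, 11, 8, 0), (0, 10, 8, 1), (2, 8, 9, 0),
      (1, 8, 9, 1), (1, 9, 8, 1), (0, 9, 8, 2), (1, 10, 8, 0), (2, 7, 10, 0),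
      (3, 7, 9, 0), (2, 7, 9, 1), (3, 5, 10, 1), (1, 7, 9, 2), (3, 6, 10, 0),
      (4, 5, 10, 0), (0, 8, 8, 3), (2, 6, 9, 2), (5, 3, 11, 0), (5, 2, 11, 1)]⟩]
  t := [
    ⟨(46, 26, 0, 37), 305, [
      (0, 10, 9, 0), (1, 9, 9, 0), (1, 8, 9, 1), (0, 10, 8, 1), (2, 8, 9, 0),
      (0, 11, 8, 0), (2, 7, 10, 0), (1, 7, 9, 2), (3, 6, 10, 0), (3, 5, 10, 1)]⟩,
    ⟨(45, 26, 0, 36), 318, [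
      (0, 9, 8, 2), (1, 9, 8, 1), (0, 8, 8, 3), (5, 3, 11, 0), (2, 7, 9, 1),
      (1, 10, 8, 0), (4, 5, 10, 0), (5, 2, 11, 1), (2, 6, 9, 2), (3, 7, 9, 0)]⟩]

/-- Block 18. -/
def blk18 : Blk where
  q := [
    ⟨(47, 13, 0, 38), 252, [
      (0, 11, 7, 1), (1, 11, 7, 0), (0, 10, 7, 2), (0, 11, 6, 2), (2, 10, 7, 0),
      (1, 10, 7, 1), (1, 11, 6, 1), (0, 9, 7, 3), (0, 10, 6, 3), (1, 8, 8, 2),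
      (3, 8, 8, 0), (2, 11, 6, 0), (2, 9, 7, 1), (1, 9, 7, 2), (2, 8, 8, 1),
      (1, 12, 6, 0), (2, 9, 8, 0), (1, 7, 8, 3), (1, 12, 5, 1), (2, 12, 5, 0)]⟩]
  t := [
    ⟨(18, 4, 0, 12), 74, [
      (0, 11, 7, 1), (1, 11, 7, 0), (0, 10, 7, 2), (0, 11, 6, 2), (2, 9, 8, 0),
      (1, 10, 7, 1), (1, 11, 6, 1), (0, 9, 7, 3), (1, 12, 6, 0), (1, 8, 8, 2)]⟩,
    ⟨(47, 14, 0, 38), 262, [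
      (0, 10, 6, 3), (2, 10, 7, 0), (2, 9, 7, 1), (2, 8, 8, 1), (1, 7, 8, 3),
      (1, 9, 7, 2), (1, 12, 5, 1), (2, 11, 6, 0), (3, 8, 8, 0), (2, 12, 5, 0)]⟩]

/-- Block 19. -/
def blk19 : Blk where
  q := [
    ⟨(118, 0, 64, 84), 656, [
      (0, 11, 5, 3), (1, 11, 5, 2), (0, 10, 5, 4), (0, 11, 4, 4), (2, 11, 5, 1),
      (1, 12, 4, 2), (1, 11, 4, 3), (2, 12, 4, 1), (2, 13, 4, 0), (1, 11, 3, 4),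
      (3, 12, 4, 0), (3, 13, 3, 0), (2, 12, 3, 2), (4, 13, 2, 0), (3, 12, 2, 2),
      (2, 12, 2, 3), (5, 13, 1, 0), (3, 13, 2, 1), (4, 13, 1, 1), (3, 12, 3, 1)]⟩]
  t := [
    ⟨(54, 0, 25, 37), 262, [
      (0, 11, 5, 3), (1, 11, 5, 2), (1, 12, 4, 2), (0, 11, 4, 4), (2, 13, 4, 0),
      (2, 12, 4, 1), (3, 12, 4, 0), (3, 13, 3, 0), (2, 12, 3, 2), (3, 13, 2, 1)]⟩,
    ⟨(118, 0, 65, 85), 665, [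
      (0, 10, 5, 4), (2, 11, 5, 1), (2, 12, 2, 3), (4, 13, 1, 1), (4, 13, 2, 0),
      (1, 11, 4, 3), (3, 12, 3, 1), (5, 13, 1, 0), (3, 12, 2, 2), (1, 11, 3, 4)]⟩]

/-- Block 20. -/
def blk20 : Blk where
  q := [
    ⟨(43, 19, 0, 32), 301, [
      (0, 8, 7, 4), (1, 8, 7, 3), (0, 7, 7, 5), (0, 9, 6, 4), (3, 9, 7, 0),
      (1, 10, 6, 2), (3, 4, 9, 3), (1, 6, 8, 4), (3, 7, 8, 1), (3, 6, 9, 1),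
      (2, 6, 8, 3), (2, 5, 9, 3), (4, 4, 10, 1), (2, 7, 8, 2), (4, 6, 9, 0),
      (3, 5, 9, 2), (5, 4, 10, 0), (4, 3, 10, 2), (6, 2, 11, 0), (4, 5, 9, 1)]⟩]
  t := [
    ⟨(45, 16, 0, 34), 279, [
      (0, 8, 7, 4), (1, 8, 7, 3), (3, 9, 7, 0), (3, 6, 9, 1), (4, 6, 9, 0),
      (2, 5, 9, 3), (2, 7, 8, 2), (1, 10, 6, 2), (1, 6, 8, 4), (4, 4, 10, 1)]⟩,
    ⟨(50, 22, 0, 37), 349, [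
      (0, 7, 7, 5), (3, 7, 8, 1), (0, 9, 6, 4), (2, 6, 8, 3), (5, 4, 10, 0),
      (3, 4, 9, 3), (3, 5, 9, 2), (4, 3, 10, 2), (6, 2, 11, 0), (4, 5, 9, 1)]⟩]

/-- Block 21. -/
def blk21 : Blk where
  q := [
    ⟨(32, 28, 0, 20), 276, [
      (7, 0, 11, 1), (8, 0, 11, 0), (7, 1, 11, 0), (7, 0, 10, 2), (6, 0, 10, 3),
      (6, 1, 10, 2), (8, 0, 10, 1), (6, 2, 10, 1), (7, 1, 10, 1), (6, 0, 9, 4),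
      (5, 2, 10, 2), (5, 3, 10, 1), (6, 1, 11, 1), (5, 1, 9, 4), (4, 2, 9, 4),
      (4, 3, 9, 3), (6, 3, 10, 0), (5, 2, 9, 3), (2, 4, 8, 5), (4, 1, 8, 6)]⟩]
  t := [
    ⟨(66, 52, 0, 36), 526, [
      (7, 0, 11, 1), (6, 0, 10, 3), (7, 1, 11, 0), (6, 1, 11, 1), (5, 2, 10, 2),
      (6, 1, 10, 2), (4, 2, 9, 4), (5, 3, 10, 1), (5, 1, 9, 4), (2, 4, 8, 5)]⟩,
    ⟨(31, 27, 0, 19), 267, [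
      (8, 0, 11, 0), (7, 0, 10, 2), (7, 1, 10, 1), (8, 0, 10, 1), (6, 2, 10, 1),
      (6, 3, 10, 0), (6, 0, 9, 4), (4, 3, 9, 3), (4, 1, 8, 6), (5, 2, 9, 3)]⟩]

/-- Block 22. -/
def blk22 : Blk where
  q := [
    ⟨(180, 0, 31, 121), 844, [
      (0, 10, 4, 5), (1, 10, 4, 4), (0, 9, 5, 5), (0, 10, 3, 6), (2, 10, 6, 1),
      (1, 9, 5, 4), (1, 10, 5, 3), (0, 8, 6, 5), (1, 9, 6, 3), (3, 10, 5, 1),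
      (3, 10, 6, 0), (2, 9, 6, 2), (2, 10, 5, 2), (3, 11, 5, 0), (3, 11, 4, 1),
      (4, 12, 3, 0), (2, 11, 4, 2), (2, 11, 3, 3), (2, 8, 7, 2), (4, 11, 4, 0)]⟩]
  t := [
    ⟨(45, 0, 5, 34), 190, [
      (0, 10, 4, 5), (1, 10, 5, 3), (3, 11, 5, 0), (2, 10, 5, 2), (2, 10, 6, 1),
      (2, 11, 4, 2), (3, 10, 6, 0), (1, 9, 6, 3), (2, 9, 6, 2), (3, 11, 4, 1)]⟩,
    ⟨(184, 0, 31, 124), 860, [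
      (0, 9, 5, 5), (1, 9, 5, 4), (0, 8, 6, 5), (0, 10, 3, 6), (3, 10, 5, 1),
      (4, 12, 3, 0), (1, 10, 4, 4), (2, 8, 7, 2), (2, 11, 3, 3), (4, 11, 4, 0)]⟩]

/-- Block 23. -/
def blk23 : Blk where
  q := [
    ⟨(273, 174, 141, 0), 1506, [
      (0, 8, 0, 11), (1, 7, 0, 11), (0, 7, 1, 11), (0, 7, 2, 10), (2, 5, 0, 12),
      (4, 2, 0, 13), (1, 5, 1, 12), (0, 6, 3, 10), (3, 2, 1, 13), (2, 4, 1, 12),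
      (1, 6, 1, 11), (4, 1, 1, 13), (5, 0, 1, 13), (3, 3, 1, 12), (2, 3, 2, 12),
      (4, 0, 2, 13), (1, 5, 2, 11), (3, 1, 3, 12), (3, 2, 2, 12), (2, 3, 3, 11)]⟩]
  t := [
    ⟨(31, 20, 15, 0), 161, [
      (0, 8, 0, 11), (1, 5, 1, 12), (0, 7, 1, 11), (2, 4, 1, 12), (3, 2, 1, 13),
      (4, 1, 1, 13), (2, 3, 2, 12), (3, 1, 3, 12), (4, 0, 2, 13), (1, 5, 2, 11)]⟩,
    ⟨(274, 175, 141, 0), 1511, [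
      (1, 7, 0, 11), (2, 5, 0, 12), (4, 2, 0, 13), (5, 0, 1, 13), (3, 3, 1, 12),
      (1, 6, 1, 11), (3, 2, 2, 12), (0, 6, 3, 10), (2, 3, 3, 11), (0, 7, 2, 10)]⟩]

/-- Block 24. -/
def blk24 : Blk where
  q := [
    ⟨(75, 0, 53, 54), 504, [
      (0, 10, 2, 7), (1, 11, 2, 5), (2, 11, 2, 4), (2, 11, 1, 5), (3, 11, 2, 3),
      (4, 12, 2, 1), (3, 11, 1, 4), (5, 12, 2, 0), (4, 12, 1, 2), (4, 12, 0, 3),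
      (3, 12, 1, 3), (6, 12, 1, 0), (5, 12, 1, 1), (1, 10, 3, 5), (6, 12, 0, 1),
      (5, 12, 0, 2), (5, 13, 0, 1), (6, 13, 0, 0), (3, 11, 0, 5), (3, 11, 3, 2)]⟩]
  t := [
    ⟨(38, 0, 33, 26), 244, [
      (5, 13, 0, 1), (6, 13, 0, 0), (5, 12, 0, 2), (3, 12, 1, 3), (4, 12, 0, 3),
      (4, 12, 1, 2), (3, 11, 0, 5), (2, 11, 1, 5), (1, 11, 2, 5), (4, 12, 2, 1)]⟩,
    ⟨(91, 0, 61, 67), 613, [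
      (0, 10, 2, 7), (1, 10, 3, 5), (3, 11, 3, 2), (3, 11, 2, 3), (2, 11, 2, 4),
      (5, 12, 2, 0), (5, 12, 1, 1), (6, 12, 1, 0), (6, 12, 0, 1), (3, 11, 1, 4)]⟩]

/-- Block 25. -/
def blk25 : Blk where
  q := [
    ⟨(39, 25, 0, 34), 352, [
      (9, 0, 10, 0), (8, 1, 10, 0), (5, 5, 9, 0), (4, 4, 9, 2), (7, 2, 10, 0),
      (5, 4, 9, 1), (6, 3, 9, 1), (5, 3, 9, 2), (4, 7, 8, 0), (3, 6, 8, 2),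
      (6, 4, 9, 0), (2, 5, 8, 4), (7, 3, 9, 0), (6, 2, 9, 2), (4, 5, 8, 2),
      (5, 6, 8, 0), (4, 6, 8, 1), (3, 5, 8, 3), (1, 7, 7, 4), (3, 8, 7, 1)]⟩]
  t := [
    ⟨(268, 183, 0, 232), 2379, [
      (8, 1, 10, 0), (7, 2, 10, 0), (5, 3, 9, 2), (5, 5, 9, 0), (4, 4, 9, 2),
      (6, 4, 9, 0), (4, 7, 8, 0), (5, 4, 9, 1), (3, 6, 8, 2), (2, 5, 8, 4)]⟩,
    ⟨(239, 158, 0, 213), 2197, [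
      (9, 0, 10, 0), (4, 6, 8, 1), (4, 5, 8, 2), (5, 6, 8, 0), (3, 5, 8, 3),
      (6, 3, 9, 1), (7, 3, 9, 0), (6, 2, 9, 2), (3, 8, 7, 1), (1, 7, 7, 4)]⟩]

/-- Block 26. -/
def blk26 : Blk where
  q := [
    ⟨(0, 200, 380, 256), 1908, [
      (13, 0, 0, 6), (12, 0, 0, 7), (13, 1, 0, 5), (13, 0, 1, 5), (11, 5, 0, 3),
      (12, 1, 0, 6), (12, 1, 1, 5), (12, 2, 0, 5), (13, 1, 1, 4), (13, 0, 2, 4),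
      (10, 8, 0, 1), (11, 4, 0, 4), (11, 5, 1, 2), (11, 3, 0, 5), (12, 2, 1, 4),
      (12, 3, 2, 2), (12, 3, 0, 4), (12, 3, 1, 3), (13, 1, 2, 3), (13, 0, 3, 3)]⟩]
  t := [
    ⟨(0, 28, 56, 38), 256, [
      (13, 0, 0, 6), (12, 1, 0, 6), (13, 1, 0, 5), (13, 0, 1, 5), (11, 5, 0, 3),
      (12, 3, 0, 4), (12, 3, 1, 3), (12, 2, 0, 5), (13, 1, 1, 4), (13, 1, 2, 3)]⟩,
    ⟨(0, 214, 383, 270), 1993, [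
      (12, 0, 0, 7), (13, 0, 2, 4), (12, 1, 1, 5), (12, 2, 1, 4), (11, 5, 1, 2),
      (11, 4, 0, 4), (13, 0, 3, 3), (12, 3, 2, 2), (10, 8, 0, 1), (11, 3, 0, 5)]⟩]

/-- Block 27. -/
def blk27 : Blk where
  q := [
    ⟨(335, 0, 173, 271), 2378, [
      (0, 9, 4, 6), (2, 10, 4, 3), (3, 10, 4, 2), (2, 10, 3, 4), (4, 10, 4, 1),
      (2, 9, 5, 3), (3, 10, 3, 3), (4, 11, 3, 1), (4, 11, 2, 2), (4, 11, 1, 3),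
      (5, 10, 4, 0), (3, 9, 6, 1), (4, 10, 5, 0), (5, 11, 2, 1), (5, 11, 3, 0),
      (1, 10, 2, 6), (7, 12, 0, 0), (6, 11, 2, 0), (2, 10, 2, 5), (4, 9, 6, 0)]⟩]
  t := [
    ⟨(361, 0, 122, 271), 2176, [
      (0, 9, 4, 6), (2, 10, 4, 3), (3, 10, 4, 2), (2, 10, 3, 4), (4, 10, 5, 0),
      (3, 9, 6, 1), (2, 9, 5, 3), (4, 11, 3, 1), (5, 11, 3, 0), (4, 9, 6, 0)]⟩,
    ⟨(333, 0, 175, 269), 2365, [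
      (7, 12, 0, 0), (4, 11, 1, 3), (4, 10, 4, 1), (4, 11, 2, 2), (5, 11, 2, 1),
      (5, 10, 4, 0), (1, 10, 2, 6), (6, 11, 2, 0), (3, 10, 3, 3), (2, 10, 2, 5)]⟩]

/-- Block 28. -/
def blk28 : Blk where
  q := [
    ⟨(0, 299, 404, 165), 1887, [
      (11, 0, 0, 8), (10, 0, 0, 9), (11, 1, 0, 7), (11, 0, 1, 7), (9, 0, 0, 10),
      (10, 1, 0, 8), (10, 0, 1, 8), (11, 2, 0, 6), (11, 1, 1, 6), (11, 0, 2, 6),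
      (8, 0, 0, 11), (9, 1, 0, 9), (12, 0, 1, 6), (10, 2, 0, 7), (10, 1, 1, 7),
      (12, 0, 2, 5), (10, 3, 0, 6), (11, 2, 1, 5), (12, 1, 2, 4), (12, 0, 3, 4)]⟩]
  t := [
    ⟨(0, 214, 283, 117), 1199, [
      (11, 0, 0, 8), (10, 0, 0, 9), (11, 1, 0, 7), (11, 0, 1, 7), (9, 0, 0, 10),
      (10, 1, 0, 8), (12, 0, 1, 6), (11, 2, 0, 6), (11, 1, 1, 6), (12, 0, 2, 5)]⟩,
    ⟨(0, 299, 406, 165), 1887, [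
      (8, 0, 0, 11), (10, 0, 1, 8), (10, 1, 1, 7), (10, 2, 0, 7), (9, 1, 0, 9),
      (11, 2, 1, 5), (12, 1, 2, 4), (10, 3, 0, 6), (11, 0, 2, 6), (12, 0, 3, 4)]⟩]

/-- Block 29. -/
def blk29 : Blk where
  q := [
    ⟨(0, 71, 63, 38), 429, [
      (9, 0, 1, 9), (10, 0, 2, 7), (10, 1, 2, 6), (10, 0, 3, 6), (13, 0, 4, 2),
      (11, 1, 2, 5), (12, 0, 4, 3), (11, 2, 2, 4), (11, 1, 3, 4), (11, 0, 4, 4),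
      (12, 1, 3, 3), (11, 0, 3, 5), (12, 0, 5, 2), (12, 2, 2, 3), (12, 1, 4, 2),
      (12, 0, 6, 1), (11, 3, 1, 4), (12, 2, 3, 2), (12, 1, 5, 1), (11, 0, 5, 3)]⟩]
  t := [
    ⟨(0, 71, 63, 38), 404, [
      (13, 0, 4, 2), (12, 0, 4, 3), (12, 1, 4, 2), (12, 0, 5, 2), (11, 0, 4, 4),
      (11, 1, 2, 5), (11, 0, 3, 5), (12, 2, 2, 3), (12, 1, 3, 3), (10, 0, 2, 7)]⟩,
    ⟨(0, 63, 56, 34), 382, [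
      (9, 0, 1, 9), (12, 0, 6, 1), (12, 1, 5, 1), (10, 0, 3, 6), (11, 0, 5, 3),
      (11, 1, 3, 4), (10, 1, 2, 6), (12, 2, 3, 2), (11, 2, 2, 4), (11, 3, 1, 4)]⟩]

/-- Block 30. -/
def blk30 : Blk where
  q := [
    ⟨(30, 0, 24, 19), 215, [
      (0, 9, 0, 10), (1, 9, 0, 9), (1, 10, 0, 8), (0, 9, 1, 9), (2, 9, 0, 8),
      (2, 10, 0, 7), (1, 9, 1, 8), (4, 11, 0, 4), (1, 10, 1, 7), (0, 9, 2, 8),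
      (3, 10, 0, 6), (4, 10, 0, 5), (2, 10, 1, 6), (5, 11, 0, 3), (3, 10, 1, 5),
      (1, 9, 2, 7), (0, 8, 1, 10), (5, 11, 1, 2), (3, 10, 2, 4), (0, 9, 3, 7)]⟩]
  t := [
    ⟨(30, 0, 24, 19), 204, [
      (0, 9, 0, 10), (1, 9, 0, 9), (1, 10, 0, 8), (0, 9, 1, 9), (2, 10, 0, 7),
      (3, 10, 0, 6), (1, 10, 1, 7), (4, 11, 0, 4), (2, 10, 1, 6), (0, 9, 2, 8)]⟩,
    ⟨(30, 0, 24, 19), 215, [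
      (0, 8, 1, 10), (1, 9, 1, 8), (0, 9, 3, 7), (1, 9, 2, 7), (2, 9, 0, 8),
      (3, 10, 1, 5), (3, 10, 2, 4), (5, 11, 0, 3), (4, 10, 0, 5), (5, 11, 1, 2)]⟩]

/-- Block 31. -/
def blk31 : Blk where
  q := [
    ⟨(46, 0, 11, 32), 281, [
      (0, 8, 5, 6), (1, 8, 5, 5), (0, 7, 5, 7), (0, 7, 6, 6), (2, 8, 5, 4),
      (1, 7, 6, 5), (1, 8, 6, 4), (3, 9, 5, 2), (2, 8, 6, 3), (0, 8, 4, 7),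
      (3, 8, 6, 2), (4, 9, 5, 1), (4, 8, 7, 0), (1, 9, 4, 5), (3, 7, 7, 2),
      (2, 9, 4, 4), (4, 10, 3, 2), (2, 7, 7, 3), (3, 9, 4, 3), (1, 9, 3, 6)]⟩]
  t := [
    ⟨(451, 0, 11, 300), 2017, [
      (0, 8, 5, 6), (1, 8, 5, 5), (0, 7, 6, 6), (1, 8, 6, 4), (2, 8, 6, 3),
      (1, 7, 6, 5), (3, 9, 5, 2), (1, 9, 4, 5), (2, 7, 7, 3), (4, 8, 7, 0)]⟩,
    ⟨(46, 0, 11, 32), 281, [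
      (0, 8, 4, 7), (2, 9, 4, 4), (3, 9, 4, 3), (1, 9, 3, 6), (4, 9, 5, 1),
      (3, 8, 6, 2), (2, 8, 5, 4), (3, 7, 7, 2), (0, 7, 5, 7), (4, 10, 3, 2)]⟩]

/-- Block 32. -/
def blk32 : Blk where
  q := [
    ⟨(280, 0, 234, 86), 1608, [
      (1, 8, 0, 10), (2, 8, 0, 9), (2, 7, 0, 10), (1, 8, 1, 9), (3, 8, 0, 8),
      (3, 9, 0, 7), (2, 8, 1, 8), (2, 6, 0, 11), (2, 7, 1, 9), (1, 8, 2, 8),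
      (0, 8, 2, 9), (1, 7, 1, 10), (0, 8, 3, 8), (0, 7, 3, 9), (1, 7, 2, 9),
      (2, 9, 2, 6), (2, 9, 1, 7), (1, 6, 2, 10), (3, 9, 1, 6), (1, 8, 3, 7)]⟩]
  t := [
    ⟨(67, 0, 49, 33), 444, [
      (1, 8, 0, 10), (2, 8, 0, 9), (3, 9, 0, 7), (1, 8, 1, 9), (0, 8, 2, 9),
      (2, 9, 2, 6), (0, 8, 3, 8), (0, 7, 3, 9), (2, 9, 1, 7), (1, 8, 2, 8)]⟩,
    ⟨(283, 0, 235, 91), 1663, [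
      (2, 7, 0, 10), (3, 8, 0, 8), (2, 6, 0, 11), (2, 7, 1, 9), (1, 7, 1, 10),
      (3, 9, 1, 6), (1, 7, 2, 9), (2, 8, 1, 8), (1, 8, 3, 7), (1, 6, 2, 10)]⟩]

/-- Block 33. -/
def blk33 : Blk where
  q := [
    ⟨(0, 415, 517, 286), 3368, [
      (8, 1, 0, 10), (9, 2, 0, 8), (9, 3, 0, 7), (9, 2, 1, 7), (10, 4, 0, 5),
      (10, 5, 0, 4), (10, 4, 1, 4), (10, 6, 0, 3), (10, 2, 1, 6), (10, 2, 2, 5),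
      (11, 4, 1, 3), (11, 3, 2, 3), (11, 4, 2, 2), (9, 1, 1, 8), (9, 0, 2, 8),
      (12, 2, 4, 1), (10, 3, 1, 5), (11, 2, 3, 3), (11, 1, 4, 3), (11, 3, 3, 2)]⟩]
  t := [
    ⟨(0, 415, 517, 286), 3239, [
      (10, 4, 0, 5), (9, 2, 0, 8), (10, 5, 0, 4), (10, 2, 1, 6), (11, 4, 1, 3),
      (9, 1, 1, 8), (12, 2, 4, 1), (10, 3, 1, 5), (11, 3, 2, 3), (11, 2, 3, 3)]⟩,
    ⟨(0, 415, 517, 285), 3366, [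
      (8, 1, 0, 10), (9, 3, 0, 7), (10, 6, 0, 3), (9, 0, 2, 8), (11, 4, 2, 2),
      (10, 2, 2, 5), (9, 2, 1, 7), (10, 4, 1, 4), (11, 1, 4, 3), (11, 3, 3, 2)]⟩]

/-- Block 34. -/
def blk34 : Blk where
  q := [
    ⟨(0, 54, 59, 19), 322, [
      (7, 0, 0, 12), (6, 0, 0, 13), (7, 1, 0, 11), (7, 0, 1, 11), (8, 0, 1, 10),
      (6, 1, 0, 12), (6, 0, 1, 12), (7, 2, 0, 10), (7, 1, 1, 10), (7, 0, 2, 10),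
      (5, 1, 0, 13), (8, 1, 1, 9), (8, 0, 2, 9), (6, 2, 0, 11), (6, 1, 1, 11),
      (8, 2, 0, 9), (8, 3, 0, 8), (8, 2, 1, 8), (9, 1, 2, 7), (9, 0, 3, 7)]⟩]
  t := [
    ⟨(0, 32, 38, 14), 204, [
      (7, 0, 0, 12), (6, 0, 0, 13), (7, 1, 0, 11), (7, 0, 1, 11), (8, 0, 1, 10),
      (6, 1, 0, 12), (8, 2, 0, 9), (7, 2, 0, 10), (8, 1, 1, 9), (8, 0, 2, 9)]⟩,
    ⟨(0, 34, 37, 12), 203, [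
      (6, 0, 1, 12), (7, 0, 2, 10), (6, 1, 1, 11), (9, 0, 3, 7), (7, 1, 1, 10),
      (5, 1, 0, 13), (8, 3, 0, 8), (6, 2, 0, 11), (9, 1, 2, 7), (8, 2, 1, 8)]⟩]

/-- Block 35. -/
def blk35 : Blk where
  q := [
    ⟨(39, 8, 0, 24), 252, [
      (0, 6, 6, 7), (1, 6, 6, 6), (1, 5, 6, 7), (0, 6, 5, 8), (2, 6, 6, 5),
      (2, 7, 6, 4), (1, 6, 7, 5), (4, 8, 6, 1), (1, 5, 7, 6), (2, 6, 7, 4),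
      (3, 6, 7, 3), (3, 7, 6, 3), (4, 6, 7, 2), (4, 7, 7, 1), (2, 5, 7, 5),
      (1, 7, 5, 6), (5, 7, 7, 0), (3, 4, 8, 4), (1, 8, 4, 6), (0, 7, 4, 8)]⟩]
  t := [
    ⟨(58, 9, 0, 36), 340, [
      (0, 6, 6, 7), (1, 6, 6, 6), (2, 7, 6, 4), (1, 6, 7, 5), (2, 6, 7, 4),
      (4, 7, 7, 1), (3, 6, 7, 3), (1, 5, 7, 6), (4, 8, 6, 1), (1, 7, 5, 6)]⟩,
    ⟨(38, 8, 0, 24), 248, [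
      (0, 6, 5, 8), (2, 6, 6, 5), (0, 7, 4, 8), (3, 7, 6, 3), (1, 5, 6, 7),
      (3, 4, 8, 4), (2, 5, 7, 5), (1, 8, 4, 6), (5, 7, 7, 0), (4, 6, 7, 2)]⟩]

/-- Block 36. -/
def blk36 : Blk where
  q := [
    ⟨(43, 0, 37, 28), 356, [
      (6, 11, 0, 2), (7, 11, 0, 1), (6, 10, 0, 3), (6, 11, 1, 1), (8, 11, 0, 0),
      (5, 10, 0, 4), (7, 11, 1, 0), (4, 9, 0, 6), (6, 10, 1, 2), (5, 10, 2, 2),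
      (5, 9, 0, 5), (4, 10, 1, 4), (4, 10, 2, 3), (3, 9, 2, 5), (5, 10, 1, 3),
      (4, 9, 1, 5), (2, 8, 2, 7), (2, 9, 3, 5), (3, 9, 3, 4), (5, 10, 3, 1)]⟩]
  t := [
    ⟨(43, 0, 37, 28), 340, [
      (6, 11, 0, 2), (7, 11, 0, 1), (5, 10, 0, 4), (6, 11, 1, 1), (4, 9, 0, 6),
      (4, 10, 1, 4), (7, 11, 1, 0), (2, 9, 3, 5), (5, 10, 1, 3), (4, 10, 2, 3)]⟩,
    ⟨(43, 0, 36, 27), 350, [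
      (6, 10, 0, 3), (8, 11, 0, 0), (5, 9, 0, 5), (6, 10, 1, 2), (5, 10, 2, 2),
      (3, 9, 2, 5), (5, 10, 3, 1), (4, 9, 1, 5), (3, 9, 3, 4), (2, 8, 2, 7)]⟩]

/-- Block 37. -/
def blk37 : Blk where
  q := [
    ⟨(0, 39, 56, 31), 373, [
      (10, 7, 0, 2), (9, 7, 0, 3), (9, 4, 0, 6), (10, 7, 1, 1), (8, 4, 0, 7),
      (10, 5, 1, 3), (9, 4, 1, 5), (9, 5, 0, 5), (9, 3, 1, 6), (10, 5, 2, 2),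
      (11, 5, 2, 1), (11, 4, 3, 1), (11, 2, 4, 2), (10, 6, 1, 2), (10, 3, 2, 4),
      (11, 3, 4, 1), (9, 6, 0, 4), (10, 4, 2, 3), (10, 1, 3, 5), (10, 2, 3, 4)]⟩]
  t := [
    ⟨(0, 420, 628, 299), 3773, [
      (9, 4, 0, 6), (8, 4, 0, 7), (9, 5, 0, 5), (9, 3, 1, 6), (10, 7, 0, 2),
      (10, 5, 1, 3), (10, 6, 1, 2), (9, 6, 0, 4), (11, 5, 2, 1), (10, 3, 2, 4)]⟩,
    ⟨(0, 38, 53, 29), 355, [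
      (9, 7, 0, 3), (10, 7, 1, 1), (9, 4, 1, 5), (10, 2, 3, 4), (11, 4, 3, 1),
      (11, 2, 4, 2), (10, 4, 2, 3), (10, 1, 3, 5), (10, 5, 2, 2), (11, 3, 4, 1)]⟩]

/-- Block 38. -/
def blk38 : Blk where
  q := [
    ⟨(0, 49, 60, 35), 452, [
      (10, 0, 4, 5), (9, 0, 4, 6), (10, 1, 4, 4), (10, 0, 5, 4), (11, 0, 6, 2),
      (11, 1, 6, 1), (11, 1, 5, 2), (10, 2, 4, 3), (11, 2, 5, 1), (11, 4, 4, 0),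
      (8, 1, 2, 8), (9, 1, 3, 6), (9, 3, 2, 5), (11, 3, 5, 0), (10, 3, 3, 3),
      (10, 6, 2, 1), (9, 5, 1, 4), (9, 2, 2, 6), (10, 4, 3, 2), (8, 3, 1, 7)]⟩]
  t := [
    ⟨(0, 44, 54, 30), 390, [
      (10, 0, 4, 5), (11, 0, 6, 2), (10, 1, 4, 4), (10, 0, 5, 4), (9, 1, 3, 6),
      (11, 1, 5, 2), (11, 2, 5, 1), (9, 2, 2, 6), (10, 3, 3, 3), (9, 3, 2, 5)]⟩,
    ⟨(0, 63, 77, 45), 581, [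
      (9, 0, 4, 6), (11, 4, 4, 0), (11, 1, 6, 1), (9, 5, 1, 4), (10, 2, 4, 3),
      (8, 1, 2, 8), (10, 4, 3, 2), (11, 3, 5, 0), (10, 6, 2, 1), (8, 3, 1, 7)]⟩]

/-- Block 39. -/
def blk39 : Blk where
  q := [
    ⟨(0, 26, 44, 38), 318, [
      (9, 10, 0, 0), (8, 10, 0, 1), (9, 9, 0, 1), (9, 9, 1, 0), (10, 7, 2, 0),
      (8, 9, 0, 2), (8, 9, 1, 1), (9, 8, 0, 2), (9, 8, 1, 1), (9, 8, 2, 0),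
      (11, 2, 6, 0), (10, 6, 3, 0), (10, 5, 3, 1), (10, 5, 4, 0), (8, 10, 1, 0),
      (10, 4, 4, 1), (9, 7, 1, 2), (9, 6, 1, 3), (9, 7, 2, 1), (9, 7, 3, 0)]⟩]
  t := [
    ⟨(0, 15, 166, 155), 452, [
      (9, 10, 0, 0), (8, 10, 0, 1), (9, 9, 0, 1), (9, 9, 1, 0), (10, 7, 2, 0),
      (8, 9, 0, 2), (8, 10, 1, 0), (9, 8, 0, 2), (9, 8, 1, 1), (9, 8, 2, 0)]⟩,
    ⟨(0, 50, 84, 71), 607, [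
      (9, 7, 1, 2), (8, 9, 1, 1), (9, 6, 1, 3), (9, 7, 2, 1), (10, 6, 3, 0),
      (10, 5, 3, 1), (10, 5, 4, 0), (10, 4, 4, 1), (11, 2, 6, 0), (9, 7, 3, 0)]⟩]

/-- Block 40. -/
def blk40 : Blk where
  q := [
    ⟨(0, 43, 49, 33), 414, [
      (11, 0, 7, 1), (10, 0, 7, 2), (11, 1, 7, 0), (11, 0, 8, 0), (9, 0, 5, 5),
      (10, 1, 5, 3), (10, 0, 6, 3), (10, 2, 5, 2), (10, 1, 6, 2), (10, 3, 5, 1),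
      (8, 0, 3, 8), (9, 1, 4, 5), (9, 2, 4, 4), (9, 2, 3, 5), (9, 4, 2, 4),
      (9, 5, 2, 3), (10, 2, 6, 1), (10, 3, 4, 2), (9, 3, 3, 4), (8, 5, 0, 6)]⟩]
  t := [
    ⟨(0, 42, 53, 38), 432, [
      (11, 0, 7, 1), (10, 0, 6, 3), (11, 1, 7, 0), (11, 0, 8, 0), (9, 4, 2, 4),
      (9, 5, 2, 3), (10, 3, 4, 2), (10, 1, 5, 3), (10, 2, 5, 2), (10, 3, 5, 1)]⟩,
    ⟨(0, 40, 46, 31), 388, [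
      (10, 0, 7, 2), (9, 0, 5, 5), (10, 1, 6, 2), (10, 2, 6, 1), (8, 0, 3, 8),
      (9, 1, 4, 5), (9, 2, 4, 4), (9, 2, 3, 5), (9, 3, 3, 4), (8, 5, 0, 6)]⟩]

/-- Block 41. -/
def blk41 : Blk where
  q := [
    ⟨(307, 0, 377, 243), 3108, [
      (7, 10, 0, 2), (6, 9, 0, 4), (7, 9, 0, 3), (7, 10, 1, 1), (4, 8, 0, 7),
      (6, 8, 0, 5), (6, 9, 1, 3), (5, 8, 0, 6), (7, 9, 1, 2), (7, 10, 2, 0),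
      (5, 9, 1, 4), (4, 9, 2, 4), (5, 9, 2, 3), (6, 10, 2, 1), (6, 10, 3, 0),
      (6, 9, 2, 2), (3, 7, 0, 9), (3, 8, 1, 7), (4, 9, 3, 3), (4, 8, 1, 6)]⟩]
  t := [
    ⟨(659, 0, 599, 479), 5929, [
      (7, 10, 0, 2), (6, 9, 0, 4), (6, 10, 2, 1), (7, 10, 1, 1), (5, 9, 1, 4),
      (4, 9, 3, 3), (6, 10, 3, 0), (3, 8, 1, 7), (4, 9, 2, 4), (7, 10, 2, 0)]⟩,
    ⟨(306, 0, 377, 242), 3096, [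
      (7, 9, 0, 3), (4, 8, 0, 7), (5, 8, 0, 6), (7, 9, 1, 2), (6, 8, 0, 5),
      (6, 9, 1, 3), (5, 9, 2, 3), (3, 7, 0, 9), (4, 8, 1, 6), (6, 9, 2, 2)]⟩]

/-- Block 42. -/
def blk42 : Blk where
  q := [
    ⟨(8, 0, 63, 39), 282, [
      (8, 8, 0, 3), (7, 8, 0, 4), (8, 7, 0, 4), (8, 8, 1, 2), (6, 7, 0, 6),
      (7, 7, 0, 5), (7, 8, 1, 3), (8, 6, 0, 5), (8, 7, 1, 3), (8, 8, 2, 1),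
      (9, 6, 2, 2), (6, 8, 1, 4), (6, 9, 3, 1), (7, 9, 2, 1), (7, 7, 1, 4),
      (7, 8, 2, 2), (8, 9, 2, 0), (7, 9, 3, 0), (8, 7, 2, 2), (8, 8, 3, 0)]⟩]
  t := [
    ⟨(121, 0, 330, 210), 1896, [
      (8, 8, 0, 3), (7, 8, 0, 4), (8, 7, 0, 4), (8, 8, 1, 2), (6, 8, 1, 4),
      (7, 9, 2, 1), (7, 8, 1, 3), (8, 9, 2, 0), (7, 9, 3, 0), (8, 8, 2, 1)]⟩,
    ⟨(11, 0, 64, 40), 307, [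
      (7, 7, 0, 5), (6, 7, 0, 6), (8, 6, 0, 5), (7, 7, 1, 4), (8, 7, 1, 3),
      (9, 6, 2, 2), (8, 7, 2, 2), (8, 8, 3, 0), (7, 8, 2, 2), (6, 9, 3, 1)]⟩]

/-- Block 43. -/
def blk43 : Blk where
  q := [
    ⟨(0, 100, 218, 167), 1637, [
      (7, 6, 0, 6), (8, 6, 1, 4), (8, 5, 1, 5), (8, 6, 2, 3), (9, 6, 3, 1),
      (9, 5, 3, 2), (9, 6, 4, 0), (9, 4, 3, 3), (9, 5, 4, 1), (8, 6, 3, 2),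
      (10, 4, 5, 0), (7, 8, 3, 1), (10, 3, 6, 0), (8, 4, 1, 6), (8, 5, 2, 4),
      (9, 5, 5, 0), (8, 7, 3, 1), (9, 4, 4, 2), (8, 7, 4, 0), (7, 7, 2, 3)]⟩]
  t := [
    ⟨(0, 16, 36, 33), 264, [
      (8, 6, 1, 4), (9, 6, 3, 1), (9, 5, 3, 2), (9, 6, 4, 0), (10, 4, 5, 0),
      (8, 7, 3, 1), (8, 7, 4, 0), (10, 3, 6, 0), (9, 5, 4, 1), (9, 5, 5, 0)]⟩,
    ⟨(0, 100, 229, 173), 1677, [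
      (7, 6, 0, 6), (8, 6, 2, 3), (8, 5, 2, 4), (8, 5, 1, 5), (9, 4, 3, 3),
      (7, 8, 3, 1), (9, 4, 4, 2), (8, 4, 1, 6), (7, 7, 2, 3), (8, 6, 3, 2)]⟩]

/-- Block 44. -/
def blk44 : Blk where
  q := [
    ⟨(0, 152, 332, 211), 2479, [
      (7, 5, 0, 7), (6, 5, 0, 8), (7, 4, 0, 8), (7, 5, 1, 6), (8, 5, 3, 3),
      (6, 6, 0, 7), (6, 7, 1, 5), (7, 3, 0, 9), (7, 4, 1, 7), (7, 5, 2, 5),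
      (9, 4, 5, 1), (8, 4, 3, 4), (8, 6, 4, 1), (8, 2, 2, 7), (8, 4, 2, 5),
      (8, 3, 2, 6), (7, 6, 1, 5), (7, 3, 1, 8), (7, 6, 2, 4), (9, 3, 4, 3)]⟩]
  t := [
    ⟨(0, 19, 51, 30), 336, [
      (7, 5, 0, 7), (6, 5, 0, 8), (7, 4, 0, 8), (7, 5, 1, 6), (8, 4, 2, 5),
      (6, 6, 0, 7), (6, 7, 1, 5), (7, 3, 0, 9), (7, 6, 1, 5), (7, 6, 2, 4)]⟩,
    ⟨(0, 153, 333, 212), 2491, [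
      (7, 4, 1, 7), (8, 4, 3, 4), (8, 5, 3, 3), (8, 3, 2, 6), (9, 4, 5, 1),
      (7, 3, 1, 8), (9, 3, 4, 3), (8, 2, 2, 7), (8, 6, 4, 1), (7, 5, 2, 5)]⟩]

/-- Block 45. -/
def blk45 : Blk where
  q := [
    ⟨(4, 0, 53, 21), 227, [
      (5, 7, 0, 7), (4, 7, 0, 8), (5, 6, 0, 8), (5, 7, 1, 6), (3, 6, 0, 10),
      (4, 6, 0, 9), (4, 7, 1, 7), (5, 5, 0, 9), (5, 6, 1, 7), (5, 8, 2, 4),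
      (6, 6, 1, 6), (6, 5, 1, 7), (6, 8, 2, 3), (4, 5, 0, 10), (4, 8, 2, 5),
      (6, 4, 0, 9), (5, 8, 1, 5), (6, 7, 2, 4), (5, 9, 3, 2), (6, 8, 3, 2)]⟩]
  t := [
    ⟨(11, 0, 55, 20), 239, [
      (5, 7, 0, 7), (4, 7, 0, 8), (5, 6, 0, 8), (5, 7, 1, 6), (3, 6, 0, 10),
      (4, 6, 0, 9), (4, 7, 1, 7), (5, 5, 0, 9), (5, 8, 1, 5), (6, 8, 2, 3)]⟩,
    ⟨(4, 0, 54, 21), 229, [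
      (6, 4, 0, 9), (4, 5, 0, 10), (6, 6, 1, 6), (6, 5, 1, 7), (5, 6, 1, 7),
      (5, 8, 2, 4), (5, 9, 3, 2), (6, 7, 2, 4), (6, 8, 3, 2), (4, 8, 2, 5)]⟩]

/-- Block 46. -/
def blk46 : Blk where
  q := [
    ⟨(0, 12, 65, 32), 388, [
      (6, 3, 0, 10), (5, 3, 0, 11), (5, 4, 0, 10), (6, 4, 1, 8), (7, 4, 2, 6),
      (5, 5, 1, 8), (6, 6, 2, 5), (5, 7, 2, 5), (6, 7, 3, 3), (6, 9, 4, 0),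
      (8, 5, 4, 2), (7, 7, 4, 1), (7, 7, 3, 2), (5, 8, 3, 3), (7, 8, 4, 0),
      (7, 6, 3, 3), (7, 2, 1, 9), (6, 5, 2, 6), (7, 5, 3, 4), (6, 8, 4, 1)]⟩]
  t := [
    ⟨(0, 79, 514, 217), 2666, [
      (6, 3, 0, 10), (5, 3, 0, 11), (5, 4, 0, 10), (6, 4, 1, 8), (7, 4, 2, 6),
      (6, 6, 2, 5), (7, 7, 3, 2), (7, 2, 1, 9), (5, 5, 1, 8), (5, 7, 2, 5)]⟩,
    ⟨(0, 11, 65, 32), 380, [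
      (7, 8, 4, 0), (6, 8, 4, 1), (6, 9, 4, 0), (6, 7, 3, 3), (8, 5, 4, 2),
      (7, 7, 4, 1), (7, 6, 3, 3), (5, 8, 3, 3), (7, 5, 3, 4), (6, 5, 2, 6)]⟩]

/-- Block 47. -/
def blk47 : Blk where
  q := [
    ⟨(0, 5, 9, 1), 36, [
      (5, 2, 0, 12), (4, 3, 0, 12), (4, 4, 0, 11), (5, 2, 1, 11), (3, 4, 0, 12),
      (3, 5, 0, 11), (4, 3, 1, 11), (5, 1, 1, 12), (5, 1, 2, 11), (5, 3, 1, 10),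
      (6, 2, 1, 10), (5, 0, 2, 12), (7, 2, 2, 8), (4, 2, 1, 12), (6, 0, 2, 11),
      (4, 1, 2, 12), (6, 1, 2, 10), (7, 1, 2, 9), (6, 3, 1, 9), (7, 0, 3, 9)]⟩]
  t := [
    ⟨(0, 20, 56, 17), 286, [
      (5, 2, 0, 12), (4, 3, 0, 12), (4, 4, 0, 11), (5, 2, 1, 11), (6, 2, 1, 10),
      (6, 3, 1, 9), (3, 4, 0, 12), (5, 1, 1, 12), (5, 3, 1, 10), (7, 1, 2, 9)]⟩,
    ⟨(0, 23, 42, 4), 162, [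
      (6, 0, 2, 11), (5, 0, 2, 12), (6, 1, 2, 10), (7, 0, 3, 9), (4, 1, 2, 12),
      (5, 1, 2, 11), (4, 2, 1, 12), (7, 2, 2, 8), (4, 3, 1, 11), (3, 5, 0, 11)]⟩]

/-- Block 48. -/
def blk48 : Blk where
  q := [
    ⟨(0, 31, 33, 12), 249, [
      (8, 0, 4, 7), (7, 0, 4, 8), (8, 1, 4, 6), (8, 0, 5, 6), (6, 0, 4, 9),
      (7, 1, 4, 7), (7, 0, 5, 7), (8, 2, 3, 6), (8, 1, 3, 7), (6, 0, 3, 10),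
      (5, 0, 3, 11), (6, 1, 3, 9), (4, 0, 3, 12), (7, 2, 3, 7), (7, 1, 3, 8),
      (9, 1, 5, 4), (7, 3, 2, 7), (6, 2, 2, 9), (5, 2, 2, 10), (9, 0, 6, 4)]⟩]
  t := [
    ⟨(0, 3571, 4411, 1771), 32681, [
      (8, 0, 4, 7), (7, 0, 4, 8), (8, 1, 4, 6), (8, 0, 5, 6), (6, 0, 3, 10),
      (7, 1, 3, 8), (6, 2, 2, 9), (8, 2, 3, 6), (8, 1, 3, 7), (7, 3, 2, 7)]⟩,
    ⟨(0, 32, 33, 12), 250, [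
      (5, 0, 3, 11), (4, 0, 3, 12), (6, 1, 3, 9), (6, 0, 4, 9), (9, 0, 6, 4),
      (9, 1, 5, 4), (7, 0, 5, 7), (7, 2, 3, 7), (7, 1, 4, 7), (5, 2, 2, 10)]⟩]

/-- Block 49. -/
def blk49 : Blk where
  q := [
    ⟨(45, 22, 0, 36), 404, [
      (6, 1, 9, 3), (7, 2, 9, 1), (8, 2, 9, 0), (4, 2, 8, 5), (4, 4, 8, 3),
      (5, 5, 8, 1), (7, 4, 8, 0), (4, 3, 8, 4), (6, 5, 8, 0), (6, 6, 7, 0),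
      (5, 4, 8, 2), (6, 4, 8, 1), (5, 6, 7, 1), (3, 3, 8, 5), (4, 5, 7, 3),
      (3, 5, 7, 4), (5, 3, 8, 3), (2, 4, 7, 6), (3, 4, 7, 5), (5, 8, 6, 0)]⟩]
  t := [
    ⟨(35, 15, 0, 30), 300, [
      (5, 5, 8, 1), (6, 5, 8, 0), (5, 4, 8, 2), (5, 6, 7, 1), (4, 4, 8, 3),
      (6, 4, 8, 1), (6, 6, 7, 0), (3, 3, 8, 5), (3, 5, 7, 4), (5, 8, 6, 0)]⟩,
    ⟨(45, 22, 0, 36), 404, [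
      (6, 1, 9, 3), (7, 2, 9, 1), (8, 2, 9, 0), (4, 2, 8, 5), (4, 3, 8, 4),
      (4, 5, 7, 3), (2, 4, 7, 6), (5, 3, 8, 3), (3, 4, 7, 5), (7, 4, 8, 0)]⟩]

/-- Block 50. -/
def blk50 : Blk where
  q := [
    ⟨(0, 31, 42, 16), 331, [
      (5, 0, 4, 10), (6, 1, 4, 8), (8, 2, 4, 5), (9, 2, 5, 3), (7, 2, 4, 6),
      (8, 1, 5, 5), (6, 2, 3, 8), (6, 3, 2, 8), (9, 1, 6, 3), (7, 4, 3, 5),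
      (8, 3, 4, 4), (6, 3, 3, 7), (7, 3, 3, 6), (6, 4, 2, 7), (8, 3, 3, 5),
      (4, 4, 1, 10), (5, 4, 1, 9), (5, 3, 2, 9), (5, 1, 3, 10), (4, 2, 2, 11)]⟩]
  t := [
    ⟨(0, 39, 48, 17), 364, [
      (5, 0, 4, 10), (8, 2, 4, 5), (5, 1, 3, 10), (5, 4, 1, 9), (6, 3, 2, 8),
      (8, 3, 3, 5), (7, 3, 3, 6), (6, 2, 3, 8), (4, 2, 2, 11), (8, 1, 5, 5)]⟩,
    ⟨(0, 28, 39, 15), 307, [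
      (4, 4, 1, 10), (6, 4, 2, 7), (5, 3, 2, 9), (8, 3, 4, 4), (6, 1, 4, 8),
      (7, 2, 4, 6), (9, 2, 5, 3), (6, 3, 3, 7), (7, 4, 3, 5), (9, 1, 6, 3)]⟩]

/-- Block 51. -/
def blk51 : Blk where
  q := [
    ⟨(0, 79, 76, 21), 617, [
      (4, 0, 4, 11), (6, 0, 5, 8), (4, 1, 4, 10), (4, 0, 5, 10), (5, 0, 5, 9),
      (6, 1, 5, 7), (6, 0, 6, 7), (4, 2, 3, 10), (7, 1, 5, 6), (8, 0, 7, 4),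
      (7, 0, 6, 6), (4, 1, 3, 11), (8, 0, 6, 5), (5, 2, 3, 9), (5, 1, 4, 9),
      (9, 0, 7, 3), (4, 3, 2, 10), (6, 2, 4, 7), (3, 1, 4, 11), (3, 2, 3, 11)]⟩]
  t := [
    ⟨(0, 86, 76, 15), 546, [
      (4, 0, 4, 11), (6, 0, 5, 8), (4, 1, 4, 10), (4, 0, 5, 10), (5, 0, 5, 9),
      (5, 1, 4, 9), (8, 0, 6, 5), (5, 2, 3, 9), (4, 1, 3, 11), (7, 0, 6, 6)]⟩,
    ⟨(0, 81, 75, 20), 607, [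
      (9, 0, 7, 3), (8, 0, 7, 4), (7, 1, 5, 6), (6, 0, 6, 7), (6, 1, 5, 7),
      (3, 1, 4, 11), (4, 2, 3, 10), (4, 3, 2, 10), (6, 2, 4, 7), (3, 2, 3, 11)]⟩]

/-- Block 52. -/
def blk52 : Blk where
  q := [
    ⟨(88, 84, 0, 57), 862, [
      (5, 0, 8, 6), (6, 0, 8, 5), (5, 1, 8, 5), (5, 0, 7, 7), (7, 0, 8, 4),
      (6, 1, 8, 4), (4, 0, 7, 8), (5, 2, 8, 4), (4, 1, 7, 7), (7, 0, 9, 3),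
      (8, 0, 9, 2), (7, 1, 9, 2), (9, 0, 9, 1), (4, 2, 7, 6), (8, 1, 9, 1),
      (2, 2, 6, 9), (3, 3, 7, 6), (3, 2, 7, 7), (3, 1, 6, 9), (2, 3, 7, 7)]⟩]
  t := [
    ⟨(755, 615, 0, 455), 6825, [
      (5, 0, 8, 6), (6, 0, 8, 5), (5, 1, 8, 5), (7, 0, 9, 3), (4, 0, 7, 8),
      (7, 1, 9, 2), (3, 2, 7, 7), (5, 2, 8, 4), (4, 1, 7, 7), (2, 3, 7, 7)]⟩,
    ⟨(93, 86, 0, 60), 905, [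
      (8, 0, 9, 2), (9, 0, 9, 1), (8, 1, 9, 1), (5, 0, 7, 7), (7, 0, 8, 4),
      (3, 1, 6, 9), (6, 1, 8, 4), (2, 2, 6, 9), (4, 2, 7, 6), (3, 3, 7, 6)]⟩]

/-- Block 53. -/
def blk53 : Blk where
  q := [
    ⟨(116, 228, 58, 0), 1218, [
      (4, 0, 6, 9), (5, 0, 6, 8), (4, 1, 6, 8), (6, 0, 7, 6), (7, 0, 7, 5),
      (5, 1, 6, 7), (5, 1, 7, 6), (3, 2, 6, 8), (4, 1, 5, 9), (5, 1, 5, 8),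
      (3, 1, 5, 10), (3, 2, 5, 9), (2, 2, 5, 10), (2, 3, 5, 9), (4, 2, 5, 8),
      (3, 2, 4, 10), (2, 3, 4, 10), (3, 3, 2, 11), (4, 2, 4, 9), (3, 3, 3, 10)]⟩]
  t := [
    ⟨(67, 150, 62, 0), 811, [
      (4, 0, 6, 9), (5, 0, 6, 8), (4, 1, 6, 8), (4, 1, 5, 9), (3, 1, 5, 10),
      (5, 1, 5, 8), (2, 2, 5, 10), (3, 2, 5, 9), (3, 2, 4, 10), (3, 3, 2, 11)]⟩,
    ⟨(119, 246, 72, 0), 1345, [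
      (6, 0, 7, 6), (7, 0, 7, 5), (5, 1, 7, 6), (5, 1, 6, 7), (3, 2, 6, 8),
      (4, 2, 4, 9), (3, 3, 3, 10), (2, 3, 4, 10), (2, 3, 5, 9), (4, 2, 5, 8)]⟩]

/-- Block 54. -/
def blk54 : Blk where
  q := [
    ⟨(58, 9, 0, 43), 422, [
      (1, 6, 5, 7), (2, 7, 5, 5), (5, 9, 5, 0), (5, 9, 4, 1), (3, 8, 5, 3),
      (6, 8, 5, 0), (3, 8, 4, 4), (4, 8, 5, 2), (2, 8, 4, 5), (5, 7, 6, 1),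
      (5, 8, 5, 1), (3, 7, 5, 4), (4, 9, 4, 2), (4, 7, 6, 2), (6, 7, 6, 0),
      (4, 6, 6, 3), (1, 7, 4, 7), (3, 6, 6, 4), (2, 5, 6, 6), (5, 5, 7, 2)]⟩]
  t := [
    ⟨(272, 0, 60, 211), 1900, [
      (5, 9, 5, 0), (3, 8, 5, 3), (5, 8, 5, 1), (5, 9, 4, 1), (4, 8, 5, 2),
      (4, 9, 4, 2), (2, 8, 4, 5), (2, 7, 5, 5), (3, 8, 4, 4), (4, 7, 6, 2)]⟩,
    ⟨(59, 9, 0, 44), 430, [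
      (1, 6, 5, 7), (3, 6, 6, 4), (5, 7, 6, 1), (4, 6, 6, 3), (6, 7, 6, 0),
      (2, 5, 6, 6), (3, 7, 5, 4), (6, 8, 5, 0), (5, 5, 7, 2), (1, 7, 4, 7)]⟩]

/-- Block 55. -/
def blk55 : Blk where
  q := [
    ⟨(52, 0, 22, 34), 434, [
      (0, 6, 4, 9), (1, 6, 4, 8), (2, 7, 4, 6), (1, 6, 3, 9), (2, 6, 4, 7),
      (3, 7, 4, 5), (2, 7, 3, 7), (4, 8, 4, 3), (4, 8, 3, 4), (2, 7, 2, 8),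
      (4, 7, 4, 4), (5, 8, 4, 2), (3, 7, 3, 6), (2, 8, 3, 6), (1, 7, 3, 8),
      (3, 8, 2, 6), (1, 5, 5, 8), (3, 8, 3, 5), (2, 6, 5, 6), (4, 7, 5, 3)]⟩]
  t := [
    ⟨(101, 0, 35, 46), 644, [
      (0, 6, 4, 9), (1, 6, 4, 8), (2, 7, 4, 6), (1, 6, 3, 9), (1, 7, 3, 8),
      (2, 8, 3, 6), (2, 7, 3, 7), (1, 5, 5, 8), (3, 8, 3, 5), (2, 7, 2, 8)]⟩,
    ⟨(52, 0, 23, 34), 436, [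
      (4, 8, 4, 3), (5, 8, 4, 2), (4, 7, 4, 4), (4, 8, 3, 4), (3, 7, 4, 5),
      (2, 6, 4, 7), (3, 7, 3, 6), (3, 8, 2, 6), (4, 7, 5, 3), (2, 6, 5, 6)]⟩]

/-- Block 56. -/
def blk56 : Blk where
  q := [
    ⟨(205, 163, 0, 151), 2147, [
      (10, 0, 9, 0), (8, 0, 8, 3), (8, 1, 8, 2), (9, 0, 8, 2), (7, 1, 8, 3),
      (7, 2, 8, 2), (9, 1, 9, 0), (8, 2, 8, 1), (5, 2, 7, 5), (1, 4, 6, 8),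
      (6, 2, 8, 3), (6, 3, 8, 2), (4, 3, 7, 5), (7, 3, 8, 1), (2, 3, 6, 8),
      (4, 4, 7, 4), (8, 3, 8, 0), (5, 3, 7, 4), (2, 4, 6, 7), (5, 4, 7, 3)]⟩]
  t := [
    ⟨(29, 26, 0, 18), 288, [
      (8, 0, 8, 3), (7, 1, 8, 3), (6, 3, 8, 2), (1, 4, 6, 8), (6, 2, 8, 3),
      (2, 4, 6, 7), (2, 3, 6, 8), (4, 3, 7, 5), (5, 2, 7, 5), (9, 1, 9, 0)]⟩,
    ⟨(198, 156, 0, 147), 2076, [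
      (10, 0, 9, 0), (9, 0, 8, 2), (8, 1, 8, 2), (7, 3, 8, 1), (7, 2, 8, 2),
      (8, 2, 8, 1), (5, 4, 7, 3), (8, 3, 8, 0), (5, 3, 7, 4), (4, 4, 7, 4)]⟩]

/-- Block 57. -/
def blk57 : Blk where
  q := [
    ⟨(59, 239, 119, 0), 1486, [
      (2, 5, 1, 11), (3, 4, 1, 11), (2, 4, 2, 11), (3, 4, 2, 10), (4, 4, 2, 9),
      (5, 2, 4, 8), (2, 4, 3, 10), (5, 3, 3, 8), (5, 2, 5, 7), (6, 1, 6, 6),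
      (4, 3, 3, 9), (7, 1, 6, 5), (6, 1, 7, 5), (3, 3, 4, 9), (4, 2, 6, 7),
      (4, 3, 4, 8), (8, 1, 6, 4), (6, 2, 5, 6), (7, 2, 5, 5), (7, 1, 7, 4)]⟩]
  t := [
    ⟨(59, 209, 61, 0), 1049, [
      (6, 1, 6, 6), (7, 1, 6, 5), (4, 2, 6, 7), (6, 1, 7, 5), (8, 1, 6, 4),
      (5, 2, 4, 8), (7, 1, 7, 4), (4, 3, 3, 9), (5, 2, 5, 7), (3, 3, 4, 9)]⟩,
    ⟨(54, 241, 119, 0), 1455, [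
      (3, 4, 1, 11), (2, 4, 2, 11), (2, 5, 1, 11), (3, 4, 2, 10), (4, 4, 2, 9),
      (5, 3, 3, 8), (2, 4, 3, 10), (6, 2, 5, 6), (4, 3, 4, 8), (7, 2, 5, 5)]⟩]

/-- Block 58. -/
def blk58 : Blk where
  q := [
    ⟨(0, 481, 330, 120), 3544, [
      (10, 0, 8, 1), (9, 1, 8, 1), (10, 1, 8, 0), (10, 1, 7, 1), (8, 1, 7, 3),
      (8, 2, 7, 2), (9, 1, 7, 2), (10, 2, 7, 0), (8, 2, 5, 4), (8, 2, 6, 3),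
      (7, 2, 6, 4), (9, 2, 7, 1), (9, 2, 6, 2), (9, 3, 6, 1), (6, 2, 6, 5),
      (7, 3, 4, 5), (6, 3, 4, 6), (9, 3, 5, 2), (8, 3, 5, 3), (5, 4, 2, 8)]⟩]
  t := [
    ⟨(0, 308, 158, 4), 1576, [
      (10, 0, 8, 1), (9, 1, 8, 1), (10, 1, 8, 0), (10, 1, 7, 1), (8, 1, 7, 3),
      (8, 2, 5, 4), (9, 1, 7, 2), (9, 2, 6, 2), (7, 3, 4, 5), (8, 2, 6, 3)]⟩,
    ⟨(0, 482, 329, 119), 3539, [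
      (10, 2, 7, 0), (9, 2, 7, 1), (9, 3, 5, 2), (9, 3, 6, 1), (8, 2, 7, 2),
      (8, 3, 5, 3), (6, 3, 4, 6), (5, 4, 2, 8), (7, 2, 6, 4), (6, 2, 6, 5)]⟩]

/-- Block 59. -/
def blk59 : Blk where
  q := [
    ⟨(0, 389, 270, 180), 3478, [
      (9, 2, 8, 0), (7, 2, 7, 3), (7, 3, 7, 2), (7, 3, 5, 4), (5, 2, 6, 6),
      (9, 3, 7, 0), (8, 3, 6, 2), (7, 4, 5, 3), (7, 4, 4, 4), (7, 3, 6, 3),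
      (8, 3, 7, 1), (6, 2, 7, 4), (8, 4, 4, 3), (9, 4, 6, 0), (8, 4, 5, 2),
      (8, 4, 6, 1), (8, 5, 5, 1), (6, 3, 5, 5), (6, 4, 3, 6), (8, 4, 7, 0)]⟩]
  t := [
    ⟨(0, 91, 56, 34), 711, [
      (9, 2, 8, 0), (7, 2, 7, 3), (9, 3, 7, 0), (7, 3, 5, 4), (8, 3, 6, 2),
      (6, 2, 7, 4), (8, 3, 7, 1), (8, 4, 4, 3), (9, 4, 6, 0), (7, 3, 6, 3)]⟩,
    ⟨(0, 382, 261, 179), 3404, [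
      (8, 4, 5, 2), (7, 4, 5, 3), (8, 5, 5, 1), (8, 4, 6, 1), (6, 3, 5, 5),
      (6, 4, 3, 6), (7, 4, 4, 4), (7, 3, 7, 2), (5, 2, 6, 6), (8, 4, 7, 0)]⟩]

/-- Block 60. -/
def blk60 : Blk where
  q := [
    ⟨(33, 2, 52, 0), 263, [
      (2, 6, 1, 10), (3, 6, 1, 9), (3, 5, 1, 10), (2, 6, 2, 9), (4, 6, 1, 8),
      (4, 5, 1, 9), (3, 6, 2, 8), (3, 7, 1, 8), (3, 5, 2, 9), (2, 6, 3, 8),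
      (1, 5, 3, 10), (2, 5, 2, 10), (4, 6, 2, 7), (4, 7, 2, 6), (4, 5, 2, 8),
      (1, 5, 4, 9), (1, 4, 4, 10), (3, 7, 2, 7), (2, 5, 3, 9), (3, 4, 3, 9)]⟩]
  t := [
    ⟨(31, 41, 59, 0), 431, [
      (3, 5, 1, 10), (4, 5, 1, 9), (3, 6, 1, 9), (3, 5, 2, 9), (2, 6, 1, 10),
      (4, 6, 1, 8), (2, 5, 2, 10), (1, 4, 4, 10), (2, 6, 2, 9), (1, 5, 3, 10)]⟩,
    ⟨(32, 1, 53, 0), 259, [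
      (3, 7, 1, 8), (4, 7, 2, 6), (4, 5, 2, 8), (3, 7, 2, 7), (2, 5, 3, 9),
      (3, 6, 2, 8), (1, 5, 4, 9), (4, 6, 2, 7), (2, 6, 3, 8), (3, 4, 3, 9)]⟩]

/-- Block 61. -/
def blk61 : Blk where
  q := [
    ⟨(0, 64, 7, 43), 477, [
      (7, 4, 7, 1), (6, 4, 7, 2), (7, 5, 7, 0), (7, 4, 6, 2), (5, 4, 6, 4),
      (6, 5, 7, 1), (6, 4, 6, 3), (6, 3, 7, 3), (7, 5, 6, 1), (7, 5, 5, 2),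
      (8, 5, 6, 0), (5, 3, 6, 5), (8, 6, 5, 0), (7, 6, 6, 0), (6, 5, 6, 2),
      (6, 4, 5, 4), (6, 6, 6, 1), (6, 3, 6, 4), (7, 6, 5, 1), (7, 5, 4, 3)]⟩]
  t := [
    ⟨(0, 64, 7, 43), 419, [
      (7, 4, 7, 1), (6, 4, 7, 2), (7, 5, 7, 0), (7, 4, 6, 2), (8, 5, 6, 0),
      (6, 5, 7, 1), (6, 3, 6, 4), (6, 3, 7, 3), (7, 5, 6, 1), (8, 6, 5, 0)]⟩,
    ⟨(0, 64, 12, 42), 498, [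
      (6, 4, 6, 3), (5, 4, 6, 4), (5, 3, 6, 5), (6, 4, 5, 4), (7, 6, 6, 0),
      (6, 5, 6, 2), (7, 5, 5, 2), (6, 6, 6, 1), (7, 6, 5, 1), (7, 5, 4, 3)]⟩]

/-- Block 62. -/
def blk62 : Blk where
  q := [
    ⟨(0, 225, 89, 154), 2233, [
      (7, 6, 4, 2), (6, 6, 4, 3), (6, 4, 4, 5), (6, 6, 5, 2), (5, 4, 4, 6),
      (5, 3, 4, 7), (5, 3, 5, 6), (6, 5, 4, 4), (6, 5, 5, 3), (6, 5, 3, 5),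
      (4, 3, 5, 7), (7, 7, 5, 0), (4, 3, 6, 6), (5, 5, 5, 4), (5, 4, 5, 5),
      (5, 5, 6, 3), (6, 7, 5, 1), (5, 6, 6, 2), (6, 6, 3, 4), (4, 4, 6, 5)]⟩]
  t := [
    ⟨(0, 750, 450, 461), 7566, [
      (6, 4, 4, 5), (5, 4, 4, 6), (5, 3, 4, 7), (5, 3, 5, 6), (7, 6, 4, 2),
      (6, 5, 4, 4), (6, 5, 5, 3), (7, 7, 5, 0), (5, 4, 5, 5), (6, 5, 3, 5)]⟩,
    ⟨(0, 225, 84, 152), 2210, [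
      (6, 6, 5, 2), (5, 6, 6, 2), (5, 5, 6, 3), (6, 6, 4, 3), (4, 3, 6, 6),
      (4, 4, 6, 5), (5, 5, 5, 4), (6, 7, 5, 1), (4, 3, 5, 7), (6, 6, 3, 4)]⟩]

/-- Block 63. -/
def blk63 : Blk where
  q := [
    ⟨(36, 0, 40, 21), 424, [
      (5, 6, 2, 6), (3, 6, 3, 7), (3, 5, 3, 8), (3, 6, 4, 6), (4, 6, 3, 6),
      (4, 5, 3, 7), (4, 6, 4, 5), (4, 7, 3, 5), (3, 5, 4, 7), (3, 6, 5, 5),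
      (2, 5, 4, 8), (5, 5, 2, 7), (5, 6, 3, 5), (5, 7, 3, 4), (5, 7, 4, 3),
      (5, 7, 5, 2), (2, 4, 4, 9), (6, 7, 4, 2), (5, 6, 4, 4), (2, 5, 5, 7)]⟩]
  t := [
    ⟨(571, 0, 721, 360), 6819, [
      (4, 7, 3, 5), (5, 7, 3, 4), (4, 6, 3, 6), (5, 7, 4, 3), (3, 6, 3, 7),
      (5, 6, 3, 5), (3, 6, 4, 6), (3, 5, 3, 8), (5, 6, 2, 6), (5, 5, 2, 7)]⟩,
    ⟨(37, 0, 42, 22), 441, [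
      (2, 5, 4, 8), (3, 5, 4, 7), (2, 4, 4, 9), (2, 5, 5, 7), (4, 6, 4, 5),
      (6, 7, 4, 2), (5, 7, 5, 2), (5, 6, 4, 4), (3, 6, 5, 5), (4, 5, 3, 7)]⟩]

/-- Block 64. -/
def blk64 : Blk where
  q := [
    ⟨(0, 3689, 931, 1860), 36151, [
      (1, 4, 5, 9), (2, 4, 5, 8), (3, 3, 5, 8), (3, 3, 6, 7), (4, 4, 5, 6),
      (5, 6, 5, 3), (4, 4, 4, 7), (3, 5, 5, 6), (3, 5, 6, 5), (4, 4, 3, 8),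
      (3, 4, 5, 7), (4, 6, 5, 4), (5, 4, 3, 7), (4, 5, 5, 5), (4, 5, 6, 4),
      (3, 4, 4, 8), (5, 5, 4, 5), (3, 4, 6, 6), (5, 5, 3, 6), (4, 5, 4, 6)]⟩]
  t := [
    ⟨(175, 14, 95, 0), 1150, [
      (1, 4, 5, 9), (2, 4, 5, 8), (3, 3, 5, 8), (3, 3, 6, 7), (3, 4, 5, 7),
      (4, 5, 4, 6), (4, 4, 3, 8), (3, 5, 5, 6), (3, 4, 4, 8), (4, 4, 4, 7)]⟩,
    ⟨(105, 0, 446, 289), 4725, [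
      (5, 5, 3, 6), (4, 5, 5, 5), (4, 6, 5, 4), (5, 5, 4, 5), (3, 5, 6, 5),
      (5, 6, 5, 3), (4, 5, 6, 4), (4, 4, 5, 6), (5, 4, 3, 7), (3, 4, 6, 6)]⟩]

/-- List of blocks. -/
def startBlks : List Blk :=
  [blk0, blk1, blk2, blk3]

/-- List of blocks. -/
def flexBlks : List Blk :=
  [blk4, blk5, blk6, blk7, blk8, blk9, blk10, blk11, blk12, blk13,
    blk14, blk15, blk16, blk17, blk18, blk19, blk20, blk21, blk22, blk23,
    blk24, blk25, blk26, blk27, blk28, blk29, blk30, blk31, blk32, blk33,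
    blk34, blk35, blk36, blk37, blk38, blk39, blk40, blk41, blk42, blk43,
    blk44, blk45, blk46, blk47, blk48, blk49, blk50, blk51, blk52, blk53,
    blk54, blk55, blk56, blk57, blk58, blk59, blk60, blk61, blk62, blk63,
    blk64]


/-! ### Running the checks -/

/-- The blocks from index 65 on. -/
def rest65 : List Blk := []

theorem ok65 : checkAll rest65 = true := rfl

/-- The blocks from index 64 on. -/
def rest64 : List Blk := blk64 :: rest65

theorem ok64 : checkAll rest64 = true :=
  checkAll_cons (by decide +kernel) ok65

/-- The blocks from index 63 on. -/
def rest63 : List Blk := blk63 :: rest64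

theorem ok63 : checkAll rest63 = true :=
  checkAll_cons (by decide +kernel) ok64

/-- The blocks from index 62 on. -/
def rest62 : List Blk := blk62 :: rest63

theorem ok62 : checkAll rest62 = true :=
  checkAll_cons (by decide +kernel) ok63

/-- The blocks from index 61 on. -/
def rest61 : List Blk := blk61 :: rest62

theorem ok61 : checkAll rest61 = true :=
  checkAll_cons (by decide +kernel) ok62

/-- The blocks from index 60 on. -/
def rest60 : List Blk := blk60 :: rest61

theorem ok60 : checkAll rest60 = true :=
  checkAll_cons (by decide +kernel) ok61

/-- The blocks from index 59 on. -/
def rest59 : List Blk := blk59 :: rest60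

theorem ok59 : checkAll rest59 = true :=
  checkAll_cons (by decide +kernel) ok60

/-- The blocks from index 58 on. -/
def rest58 : List Blk := blk58 :: rest59

theorem ok58 : checkAll rest58 = true :=
  checkAll_cons (by decide +kernel) ok59

/-- The blocks from index 57 on. -/
def rest57 : List Blk := blk57 :: rest58

theorem ok57 : checkAll rest57 = true :=
  checkAll_cons (by decide +kernel) ok58

/-- The blocks from index 56 on. -/
def rest56 : List Blk := blk56 :: rest57

theorem ok56 : checkAll rest56 = true :=
  checkAll_cons (by decide +kernel) ok57

/-- The blocks from index 55 on. -/
def rest55 : List Blk := blk55 :: rest56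

theorem ok55 : checkAll rest55 = true :=
  checkAll_cons (by decide +kernel) ok56

/-- The blocks from index 54 on. -/
def rest54 : List Blk := blk54 :: rest55

theorem ok54 : checkAll rest54 = true :=
  checkAll_cons (by decide +kernel) ok55

/-- The blocks from index 53 on. -/
def rest53 : List Blk := blk53 :: rest54

theorem ok53 : checkAll rest53 = true :=
  checkAll_cons (by decide +kernel) ok54

/-- The blocks from index 52 on. -/
def rest52 : List Blk := blk52 :: rest53

theorem ok52 : checkAll rest52 = true :=
  checkAll_cons (by decide +kernel) ok53

/-- The blocks from index 51 on. -/
def rest51 : List Blk := blk51 :: rest52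

theorem ok51 : checkAll rest51 = true :=
  checkAll_cons (by decide +kernel) ok52

/-- The blocks from index 50 on. -/
def rest50 : List Blk := blk50 :: rest51

theorem ok50 : checkAll rest50 = true :=
  checkAll_cons (by decide +kernel) ok51

/-- The blocks from index 49 on. -/
def rest49 : List Blk := blk49 :: rest50

theorem ok49 : checkAll rest49 = true :=
  checkAll_cons (by decide +kernel) ok50

/-- The blocks from index 48 on. -/
def rest48 : List Blk := blk48 :: rest49

theorem ok48 : checkAll rest48 = true :=
  checkAll_cons (by decide +kernel) ok49

/-- The blocks from index 47 on. -/
def rest47 : List Blk := blk47 :: rest48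

theorem ok47 : checkAll rest47 = true :=
  checkAll_cons (by decide +kernel) ok48

/-- The blocks from index 46 on. -/
def rest46 : List Blk := blk46 :: rest47

theorem ok46 : checkAll rest46 = true :=
  checkAll_cons (by decide +kernel) ok47

/-- The blocks from index 45 on. -/
def rest45 : List Blk := blk45 :: rest46

theorem ok45 : checkAll rest45 = true :=
  checkAll_cons (by decide +kernel) ok46

/-- The blocks from index 44 on. -/
def rest44 : List Blk := blk44 :: rest45

theorem ok44 : checkAll rest44 = true :=
  checkAll_cons (by decide +kernel) ok45

/-- The blocks from index 43 on. -/
def rest43 : List Blk := blk43 :: rest44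

theorem ok43 : checkAll rest43 = true :=
  checkAll_cons (by decide +kernel) ok44

/-- The blocks from index 42 on. -/
def rest42 : List Blk := blk42 :: rest43

theorem ok42 : checkAll rest42 = true :=
  checkAll_cons (by decide +kernel) ok43

/-- The blocks from index 41 on. -/
def rest41 : List Blk := blk41 :: rest42

theorem ok41 : checkAll rest41 = true :=
  checkAll_cons (by decide +kernel) ok42

/-- The blocks from index 40 on. -/
def rest40 : List Blk := blk40 :: rest41

theorem ok40 : checkAll rest40 = true :=
  checkAll_cons (by decide +kernel) ok41

/-- The blocks from index 39 on. -/
def rest39 : List Blk := blk39 :: rest40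

theorem ok39 : checkAll rest39 = true :=
  checkAll_cons (by decide +kernel) ok40

/-- The blocks from index 38 on. -/
def rest38 : List Blk := blk38 :: rest39

theorem ok38 : checkAll rest38 = true :=
  checkAll_cons (by decide +kernel) ok39

/-- The blocks from index 37 on. -/
def rest37 : List Blk := blk37 :: rest38

theorem ok37 : checkAll rest37 = true :=
  checkAll_cons (by decide +kernel) ok38

/-- The blocks from index 36 on. -/
def rest36 : List Blk := blk36 :: rest37

theorem ok36 : checkAll rest36 = true :=
  checkAll_cons (by decide +kernel) ok37

/-- The blocks from index 35 on. -/
def rest35 : List Blk := blk35 :: rest36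

theorem ok35 : checkAll rest35 = true :=
  checkAll_cons (by decide +kernel) ok36

/-- The blocks from index 34 on. -/
def rest34 : List Blk := blk34 :: rest35

theorem ok34 : checkAll rest34 = true :=
  checkAll_cons (by decide +kernel) ok35

/-- The blocks from index 33 on. -/
def rest33 : List Blk := blk33 :: rest34

theorem ok33 : checkAll rest33 = true :=
  checkAll_cons (by decide +kernel) ok34

/-- The blocks from index 32 on. -/
def rest32 : List Blk := blk32 :: rest33

theorem ok32 : checkAll rest32 = true :=
  checkAll_cons (by decide +kernel) ok33

/-- The blocks from index 31 on. -/
def rest31 : List Blk := blk31 :: rest32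

theorem ok31 : checkAll rest31 = true :=
  checkAll_cons (by decide +kernel) ok32

/-- The blocks from index 30 on. -/
def rest30 : List Blk := blk30 :: rest31

theorem ok30 : checkAll rest30 = true :=
  checkAll_cons (by decide +kernel) ok31

/-- The blocks from index 29 on. -/
def rest29 : List Blk := blk29 :: rest30

theorem ok29 : checkAll rest29 = true :=
  checkAll_cons (by decide +kernel) ok30

/-- The blocks from index 28 on. -/
def rest28 : List Blk := blk28 :: rest29

theorem ok28 : checkAll rest28 = true :=
  checkAll_cons (by decide +kernel) ok29

/-- The blocks from index 27 on. -/
def rest27 : List Blk := blk27 :: rest28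

theorem ok27 : checkAll rest27 = true :=
  checkAll_cons (by decide +kernel) ok28

/-- The blocks from index 26 on. -/
def rest26 : List Blk := blk26 :: rest27

theorem ok26 : checkAll rest26 = true :=
  checkAll_cons (by decide +kernel) ok27

/-- The blocks from index 25 on. -/
def rest25 : List Blk := blk25 :: rest26

theorem ok25 : checkAll rest25 = true :=
  checkAll_cons (by decide +kernel) ok26

/-- The blocks from index 24 on. -/
def rest24 : List Blk := blk24 :: rest25

theorem ok24 : checkAll rest24 = true :=
  checkAll_cons (by decide +kernel) ok25

/-- The blocks from index 23 on. -/
def rest23 : List Blk := blk23 :: rest24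

theorem ok23 : checkAll rest23 = true :=
  checkAll_cons (by decide +kernel) ok24

/-- The blocks from index 22 on. -/
def rest22 : List Blk := blk22 :: rest23

theorem ok22 : checkAll rest22 = true :=
  checkAll_cons (by decide +kernel) ok23

/-- The blocks from index 21 on. -/
def rest21 : List Blk := blk21 :: rest22

theorem ok21 : checkAll rest21 = true :=
  checkAll_cons (by decide +kernel) ok22

/-- The blocks from index 20 on. -/
def rest20 : List Blk := blk20 :: rest21

theorem ok20 : checkAll rest20 = true :=
  checkAll_cons (by decide +kernel) ok21

/-- The blocks from index 19 on. -/
def rest19 : List Blk := blk19 :: rest20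

theorem ok19 : checkAll rest19 = true :=
  checkAll_cons (by decide +kernel) ok20

/-- The blocks from index 18 on. -/
def rest18 : List Blk := blk18 :: rest19

theorem ok18 : checkAll rest18 = true :=
  checkAll_cons (by decide +kernel) ok19

/-- The blocks from index 17 on. -/
def rest17 : List Blk := blk17 :: rest18

theorem ok17 : checkAll rest17 = true :=
  checkAll_cons (by decide +kernel) ok18

/-- The blocks from index 16 on. -/
def rest16 : List Blk := blk16 :: rest17

theorem ok16 : checkAll rest16 = true :=
  checkAll_cons (by decide +kernel) ok17

/-- The blocks from index 15 on. -/
def rest15 : List Blk := blk15 :: rest16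

theorem ok15 : checkAll rest15 = true :=
  checkAll_cons (by decide +kernel) ok16

/-- The blocks from index 14 on. -/
def rest14 : List Blk := blk14 :: rest15

theorem ok14 : checkAll rest14 = true :=
  checkAll_cons (by decide +kernel) ok15

/-- The blocks from index 13 on. -/
def rest13 : List Blk := blk13 :: rest14

theorem ok13 : checkAll rest13 = true :=
  checkAll_cons (by decide +kernel) ok14

/-- The blocks from index 12 on. -/
def rest12 : List Blk := blk12 :: rest13

theorem ok12 : checkAll rest12 = true :=
  checkAll_cons (by decide +kernel) ok13

/-- The blocks from index 11 on. -/
def rest11 : List Blk := blk11 :: rest12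

theorem ok11 : checkAll rest11 = true :=
  checkAll_cons (by decide +kernel) ok12

/-- The blocks from index 10 on. -/
def rest10 : List Blk := blk10 :: rest11

theorem ok10 : checkAll rest10 = true :=
  checkAll_cons (by decide +kernel) ok11

/-- The blocks from index 9 on. -/
def rest9 : List Blk := blk9 :: rest10

theorem ok9 : checkAll rest9 = true :=
  checkAll_cons (by decide +kernel) ok10

/-- The blocks from index 8 on. -/
def rest8 : List Blk := blk8 :: rest9

theorem ok8 : checkAll rest8 = true :=
  checkAll_cons (by decide +kernel) ok9

/-- The blocks from index 7 on. -/
def rest7 : List Blk := blk7 :: rest8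

theorem ok7 : checkAll rest7 = true :=
  checkAll_cons (by decide +kernel) ok8

/-- The blocks from index 6 on. -/
def rest6 : List Blk := blk6 :: rest7

theorem ok6 : checkAll rest6 = true :=
  checkAll_cons (by decide +kernel) ok7

/-- The blocks from index 5 on. -/
def rest5 : List Blk := blk5 :: rest6

theorem ok5 : checkAll rest5 = true :=
  checkAll_cons (by decide +kernel) ok6

/-- The blocks from index 4 on. -/
def rest4 : List Blk := blk4 :: rest5

theorem ok4 : checkAll rest4 = true :=
  checkAll_cons (by decide +kernel) ok5

/-- The blocks from index 3 on. -/
def rest3 : List Blk := blk3 :: rest4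

theorem ok3 : checkAll rest3 = true :=
  checkAll_cons (by decide +kernel) ok4

/-- The blocks from index 2 on. -/
def rest2 : List Blk := blk2 :: rest3

theorem ok2 : checkAll rest2 = true :=
  checkAll_cons (by decide +kernel) ok3

/-- The blocks from index 1 on. -/
def rest1 : List Blk := blk1 :: rest2

theorem ok1 : checkAll rest1 = true :=
  checkAll_cons (by decide +kernel) ok2

/-- The blocks from index 0 on. -/
def rest0 : List Blk := blk0 :: rest1

theorem ok0 : checkAll rest0 = true :=
  checkAll_cons (by decide +kernel) ok1

theorem covered : covers (groups rest0) = true := by decide +kernel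

theorem rest0_eq : rest0 = startBlks ++ flexBlks := rfl

theorem flex_lengths : ∀ B ∈ flexBlks, B.q.length = 1 ∧ B.t.length = 2 := by
  have h : flexBlks.all (fun B => Nat.beq B.q.length 1 && Nat.beq B.t.length 2) = true := by
    decide +kernel
  intro B hB
  have := List.all_eq_true.1 h B hB
  rw [Bool.and_eq_true] at this
  exact ⟨Nat.eq_of_beq_eq_true this.1, Nat.eq_of_beq_eq_true this.2⟩

/-- `L_3(19; 4^{×a}, 3^{×b})` with `2a + b = 154` is non-special of virtual dimension `−1`. -/
theorem nonSpecial_nineteen (a b : ℕ) (hab : 2 * a + b = 154) :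
    nonSpecial 19 (List.replicate a 4 ++ List.replicate b 3) ∧
      vdim 19 (List.replicate a 4 ++ List.replicate b 3) = -1 := by
  refine nonSpecial_of_solv (expo (groups rest0)) (covers_spec covered) a b hab ?_
  have h : checkAll (startBlks ++ flexBlks) = true := rest0_eq ▸ ok0
  rw [rest0_eq]
  exact solv_all startBlks flexBlks h flex_lengths rfl rfl rfl a b hab
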